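/- Let V be a linear contraction from a separable Hilbert space ℋ into a separable Hilbert space ℋ' such that λ*(√(I_ℋ − V*V)) < +∞. Then continuity of the function A ↦ H(VAV*) on a subset 𝒜 of 𝔗₊(ℋ) implies continuity of the quantum entropy A ↦ H(A) on 𝒜. -/

import Mathlib

open scoped ENNReal NNReal
open Filter Topology Classical
attribute [local instance] Classical.propDecidable

noncomputable section

namespace QIT

section Defs

variable {E F G : Type*}
variable [NormedAddCommGroup E] [InnerProductSpace ℂ E] [CompleteSpace E]
variable [NormedAddCommGroup F] [InnerProductSpace ℂ F] [CompleteSpace F]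
variable [NormedAddCommGroup G] [InnerProductSpace ℂ G] [CompleteSpace G]

/-- The real part of `⟪x, A x⟫`. -/
def qf (A : E →L[ℂ] E) (x : E) : ℝ := (inner ℂ x (A x) : ℂ).re

/-- The trace of a positive operator, as the supremum of finite diagonal sums over
finite orthonormal families.  For positive operators this coincides with the usual
trace (with value `∞` when the operator is not trace class). -/
def traceENN (A : E →L[ℂ] E) : ℝ≥0∞ :=
  ⨆ (n : ℕ) (e : Fin n → E) (_ : Orthonormal ℂ e), ∑ i, ENNReal.ofReal (qf A (e i))

/-- The trace norm `‖A‖₁`, as the supremum of `∑ |⟪e i, A (f i)⟫|` over pairs of finite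
orthonormal families; it is finite exactly on trace-class operators. -/
def traceNorm (A : E →L[ℂ] E) : ℝ≥0∞ :=
  ⨆ (n : ℕ) (e : Fin n → E) (f : Fin n → E) (_ : Orthonormal ℂ e) (_ : Orthonormal ℂ f),
    ∑ i, ENNReal.ofReal ‖(inner ℂ (e i) (A (f i)) : ℂ)‖

/-- `A` is a trace-class operator. -/
def IsTC (A : E →L[ℂ] E) : Prop := traceNorm A ≠ ∞

/-- The cone `𝔗₊(E)` of positive trace-class operators. -/
def posTC (E : Type*) [NormedAddCommGroup E] [InnerProductSpace ℂ E] [CompleteSpace E] :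
    Set (E →L[ℂ] E) := {A | A.IsPositive ∧ IsTC A}

/-- The set `𝔖(E)` of states (density operators). -/
def states (E : Type*) [NormedAddCommGroup E] [InnerProductSpace ℂ E] [CompleteSpace E] :
    Set (E →L[ℂ] E) := {A | A.IsPositive ∧ traceENN A = 1}

/-- The extended classical entropy `H({x_i}) = ∑ η(x_i) − η(∑ x_i)` of a nonnegative
summable family, written in the equivalent homogeneous form `(∑ x) · H({x_i/∑x})`. -/
def clEntropy {ι : Type*} (x : ι → ℝ) : ℝ≥0∞ :=
  ENNReal.ofReal (∑' i, x i) *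
    ∑' i, ENNReal.ofReal (Real.negMulLog (x i / (∑' j, x j)))

/-- An orthonormal subset with dense span (an orthonormal basis, as a set). -/
def IsONB (s : Set E) : Prop :=
  Orthonormal ℂ ((↑) : s → E) ∧ Dense ((Submodule.span ℂ s : Submodule ℂ E) : Set E)

/-- The quantum (von Neumann) entropy `H(A) = Tr η(A) − η(Tr A)` of a positive trace-class
operator, realized as the infimum over all orthonormal bases of the classical entropy of
the diagonal of `A` (the infimum is attained on an eigenbasis of `A`). -/
def qEntropy (A : E →L[ℂ] E) : ℝ≥0∞ :=
  ⨅ (s : Set E) (_ : IsONB s), clEntropy fun v : s => qf A v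

theorem exists_isONB (E : Type*) [NormedAddCommGroup E] [InnerProductSpace ℂ E]
    [CompleteSpace E] : ∃ s : Set E, IsONB s := by
  obtain ⟨w, b, hb⟩ := exists_hilbertBasis ℂ E
  refine ⟨w, ?_, ?_⟩
  · have h := b.orthonormal
    rwa [hb] at h
  · have h := b.dense_span
    rw [hb, Subtype.range_coe] at h
    rwa [Submodule.dense_iff_topologicalClosure_eq_top]

/-- A fixed orthonormal basis (as a set). -/
def stdONB (E : Type*) [NormedAddCommGroup E] [InnerProductSpace ℂ E] [CompleteSpace E] :
    Set E := (exists_isONB E).choose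

/-- The `ℂ`-valued trace, computed in a fixed orthonormal basis; for trace-class
operators it does not depend on the choice of the basis. -/
def traceC (A : E →L[ℂ] E) : ℂ := ∑' v : stdONB E, (inner ℂ (v : E) (A v) : ℂ)

/-- Continuity (including finiteness) of an `ℝ≥0∞`-valued function on a subset of
operators, with respect to the trace-norm distance. -/
def ContOn (f : (E →L[ℂ] E) → ℝ≥0∞) (𝒜 : Set (E →L[ℂ] E)) : Prop :=
  (∀ A ∈ 𝒜, f A ≠ ∞) ∧
  ∀ A ∈ 𝒜, ∀ ε : ℝ, 0 < ε → ∃ δ : ℝ, 0 < δ ∧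
    ∀ B ∈ 𝒜, traceNorm (B - A) < ENNReal.ofReal δ → |(f B).toReal - (f A).toReal| < ε

/-- Continuity of a real-valued function on a subset of operators with respect to the
trace-norm distance. -/
def RContOn (g : (E →L[ℂ] E) → ℝ) (𝒜 : Set (E →L[ℂ] E)) : Prop :=
  ∀ A ∈ 𝒜, ∀ ε : ℝ, 0 < ε → ∃ δ : ℝ, 0 < δ ∧
    ∀ B ∈ 𝒜, traceNorm (B - A) < ENNReal.ofReal δ → |g B - g A| < ε

/-- Boundedness of an `ℝ≥0∞`-valued function on a set. -/
def BddOn (f : (E →L[ℂ] E) → ℝ≥0∞) (𝒜 : Set (E →L[ℂ] E)) : Prop :=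
  ∃ C : ℝ, ∀ A ∈ 𝒜, f A ≤ ENNReal.ofReal C

/-- Convergence of a sequence of operators in the trace norm. -/
def TendstoTN (A : ℕ → (E →L[ℂ] E)) (A₀ : E →L[ℂ] E) : Prop :=
  ∀ ε : ℝ, 0 < ε → ∃ N : ℕ, ∀ n ≥ N, traceNorm (A n - A₀) < ENNReal.ofReal ε

/-- A positive linear map from the trace class of `E` to the trace class of `F`
(the values of `toFun` outside the trace class are irrelevant). -/
structure TraceMap (E F : Type*) [NormedAddCommGroup E] [InnerProductSpace ℂ E]
    [CompleteSpace E] [NormedAddCommGroup F] [InnerProductSpace ℂ F] [CompleteSpace F] where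
  toFun : (E →L[ℂ] E) → (F →L[ℂ] F)
  map_add : ∀ A B, IsTC A → IsTC B → toFun (A + B) = toFun A + toFun B
  map_smul : ∀ (c : ℂ) A, IsTC A → toFun (c • A) = c • toFun A
  maps_tc : ∀ A, IsTC A → IsTC (toFun A)
  pos : ∀ A, IsTC A → A.IsPositive → (toFun A).IsPositive

/-- A trace-non-increasing map. -/
def TraceMap.TNI (Φ : TraceMap E F) : Prop :=
  ∀ A, IsTC A → A.IsPositive → traceENN (Φ.toFun A) ≤ traceENN A

/-- A trace-preserving map. -/
def TraceMap.TP (Φ : TraceMap E F) : Prop :=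
  ∀ A, IsTC A → A.IsPositive → traceENN (Φ.toFun A) = traceENN A

/-- A map bounded with respect to the trace norm. -/
def TraceMap.Bounded (Φ : TraceMap E F) : Prop :=
  ∃ C : ℝ≥0, ∀ A, traceNorm (Φ.toFun A) ≤ (C : ℝ≥0∞) * traceNorm A

/-- The output entropy `H_Φ = H ∘ Φ`. -/
def outEntropy (Φ : TraceMap E F) (A : E →L[ℂ] E) : ℝ≥0∞ := qEntropy (Φ.toFun A)

/-- The rank-one operator `|x⟩⟨x|`. -/
def rankOne (x : E) : E →L[ℂ] E := (innerSL ℂ x).smulRight x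

/-- The rank-one operator `|x⟩⟨y|`. -/
def rankOneM (x y : E) : E →L[ℂ] E := (innerSL ℂ y).smulRight x

end Defs

section Defs2

variable {E F G : Type*}
variable [NormedAddCommGroup E] [InnerProductSpace ℂ E] [CompleteSpace E]
variable [NormedAddCommGroup F] [InnerProductSpace ℂ F] [CompleteSpace F]
variable [NormedAddCommGroup G] [InnerProductSpace ℂ G] [CompleteSpace G]

/-- The completely positive map `A ↦ ∑ᵢ Vᵢ A Vᵢ*` defined by a sequence of Kraus
operators. -/
def krausMap (V : ℕ → (E →L[ℂ] F)) (A : E →L[ℂ] E) : F →L[ℂ] F :=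
  ∑' i, V i ∘L A ∘L ContinuousLinearMap.adjoint (V i)

/-- The Kraus condition `∑ᵢ Vᵢ* Vᵢ ≤ I` (all partial sums are dominated by `I`). -/
def KrausTNI (V : ℕ → (E →L[ℂ] F)) : Prop :=
  ∀ n : ℕ,
    ((1 : E →L[ℂ] E) - ∑ i ∈ Finset.range n, ContinuousLinearMap.adjoint (V i) ∘L V i).IsPositive

/-- The Kraus condition `∑ᵢ Vᵢ* Vᵢ = I` (strong convergence), i.e. trace preservation. -/
def KrausTP (V : ℕ → (E →L[ℂ] F)) : Prop :=
  ∀ x : E, HasSum (fun i => (ContinuousLinearMap.adjoint (V i)) (V i x)) x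

/-- `(Φ, Φt)` is a complementary pair of quantum operations: for some Kraus
representation `Φ(·) = ∑ᵢ Vᵢ (·) Vᵢ*` and some orthonormal basis `{bᵢ}` of `G`,
`Φt(A) = ∑_{i,j} Tr[Vᵢ A Vⱼ*] |bᵢ⟩⟨bⱼ|` (characterized by its matrix entries). -/
def IsComplementaryPair (Φ : TraceMap E F) (Φt : TraceMap E G) : Prop :=
  ∃ (V : ℕ → (E →L[ℂ] F)) (b : HilbertBasis ℕ ℂ G),
    KrausTNI V ∧
    (∀ A, IsTC A → Φ.toFun A = krausMap V A) ∧
    (∀ A, IsTC A → ∀ i j : ℕ,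
      (inner ℂ (b i) (Φt.toFun A (b j)) : ℂ) =
        traceC (V i ∘L A ∘L ContinuousLinearMap.adjoint (V j)))

/-- A map (on trace-class operators) preserves continuity of the entropy:
its output entropy is continuous on every subset of the positive trace-class cone on
which the von Neumann entropy is continuous. -/
def PCE (Φf : (E →L[ℂ] E) → (F →L[ℂ] F)) : Prop :=
  ∀ 𝒜 : Set (E →L[ℂ] E), 𝒜 ⊆ posTC E → ContOn qEntropy 𝒜 →
    ContOn (fun A => qEntropy (Φf A)) 𝒜

/-- `μ` is the sequence of nonzero eigenvalues (with multiplicities, possibly padded by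
zeros) of the diagonalizable positive operator `T`, every vector orthogonal to the
eigenvectors being annihilated by `T`. -/
def IsEigenSeq (T : E →L[ℂ] E) (μ : ℕ → ℝ) : Prop :=
  ∃ e : ℕ → E,
    (∀ i j, i ≠ j → (inner ℂ (e i) (e j) : ℂ) = 0) ∧
    (∀ i, (μ i ≠ 0 → ‖e i‖ = 1) ∧ (μ i = 0 → e i = 0)) ∧
    (∀ i, T (e i) = (μ i : ℂ) • e i) ∧
    (∀ x : E, (∀ i, (inner ℂ (e i) x : ℂ) = 0) → T x = 0)

/-- `ν` is the sequence of singular values of `V` (eigenvalues of `√(V*V)`,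
equivalently `ν²` are the eigenvalues of `V*V`). -/
def IsSingularValues (V : E →L[ℂ] F) (ν : ℕ → ℝ) : Prop :=
  (∀ i, 0 ≤ ν i) ∧ IsEigenSeq (ContinuousLinearMap.adjoint V ∘L V) (fun i => ν i ^ 2)

/-- `∑ᵢ e^{−l/νᵢ²}`, the sum being taken over the indices with `νᵢ ≠ 0`. -/
def expSum (ν : ℕ → ℝ) (l : ℝ) : ℝ≥0∞ :=
  ∑' i, if ν i = 0 then 0 else ENNReal.ofReal (Real.exp (-(l / ν i ^ 2)))

/-- `λ*(V) < ∞`: `V` is compact (automatic here) and `∑ᵢ e^{−l/νᵢ²} < ∞` for some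
`l > 0`, where `{νᵢ}` are the singular values of `V`. -/
def LamStarFin (V : E →L[ℂ] F) : Prop :=
  ∃ ν : ℕ → ℝ, IsSingularValues V ν ∧ ∃ l : ℝ, 0 < l ∧ expSum ν l ≠ ∞

/-- `λ*(√S) < ∞` for a positive operator `S` (the singular values of `√S` are the
square roots of the eigenvalues of `S`). -/
def LamStarSqrtFin (S : E →L[ℂ] E) : Prop :=
  ∃ ν : ℕ → ℝ, (∀ i, 0 ≤ ν i) ∧ IsEigenSeq S (fun i => ν i ^ 2) ∧
    ∃ l : ℝ, 0 < l ∧ expSum ν l ≠ ∞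

/-- The value `λ*` associated to a sequence `ν` of singular values: the unique solution
of `∑ᵢ e^{−λ/νᵢ²} = 1` if it exists, and `inf{λ > 0 | ∑ᵢ e^{−λ/νᵢ²} < ∞}` otherwise. -/
def lamStarOf (ν : ℕ → ℝ) : ℝ≥0∞ :=
  if h : ∃ l : ℝ, expSum ν l = 1 then ENNReal.ofReal h.choose
  else ⨅ (l : ℝ) (_ : 0 < l ∧ expSum ν l ≠ ∞), ENNReal.ofReal l

/-- The parameter `λ*(V) ∈ [0,∞]` of a bounded operator `V`. -/
def lamStar (V : E →L[ℂ] F) : ℝ≥0∞ :=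
  if h : ∃ ν : ℕ → ℝ, IsSingularValues V ν then lamStarOf h.choose else ∞

/-- `rank A ≤ k`. -/
def rankLE (A : E →L[ℂ] E) (k : ℕ) : Prop :=
  Module.rank ℂ (LinearMap.range (A : E →ₗ[ℂ] E)) ≤ k

/-- The set `𝔗₊ᵏ(E)` of positive (trace-class) operators of rank at most `k`. -/
def rankCone (E : Type*) [NormedAddCommGroup E] [InnerProductSpace ℂ E] [CompleteSpace E]
    (k : ℕ) : Set (E →L[ℂ] E) := {A | A.IsPositive ∧ rankLE A k}

/-- A decomposition of `A` into a countable convex combination of positive operators of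
rank at most `k`. -/
structure Decomp (k : ℕ) (A : E →L[ℂ] E) where
  π : ℕ → ℝ
  op : ℕ → (E →L[ℂ] E)
  π_nonneg : ∀ i, 0 ≤ π i
  π_sum : HasSum π 1
  op_pos : ∀ i, (op i).IsPositive
  op_rank : ∀ i, rankLE (op i) k
  sum_eq : HasSum (fun i => π i • op i) A

/-- The `k`-order approximator `H_Φᵏ` of the output entropy of `Φ`. -/
def kApprox (Φf : (E →L[ℂ] E) → (F →L[ℂ] F)) (k : ℕ) (A : E →L[ℂ] E) : ℝ≥0∞ :=
  ⨆ d : Decomp k A, ∑' i, ENNReal.ofReal (d.π i) * qEntropy (Φf (d.op i))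

/-- The set of pure states (extreme points of `𝔖(E)`). -/
def pureStates (E : Type*) [NormedAddCommGroup E] [InnerProductSpace ℂ E]
    [CompleteSpace E] : Set (E →L[ℂ] E) := {A | ∃ x : E, ‖x‖ = 1 ∧ A = rankOne x}

end Defs2

section Tensor

variable (E F G : Type*)
variable [NormedAddCommGroup E] [InnerProductSpace ℂ E] [CompleteSpace E]
variable [NormedAddCommGroup F] [InnerProductSpace ℂ F] [CompleteSpace F]
variable [NormedAddCommGroup G] [InnerProductSpace ℂ G] [CompleteSpace G]

/-- A realization of `G` as the Hilbert tensor product `E ⊗ F`, together with the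
tensor product of (bounded) operators. -/
structure TensorData where
  tmul : E → F → G
  add_left : ∀ x y z, tmul (x + y) z = tmul x z + tmul y z
  add_right : ∀ x y z, tmul x (y + z) = tmul x y + tmul x z
  smul_left : ∀ (c : ℂ) x y, tmul (c • x) y = c • tmul x y
  smul_right : ∀ (c : ℂ) x y, tmul x (c • y) = c • tmul x y
  inner_tmul : ∀ x x' y y',
    (inner ℂ (tmul x y) (tmul x' y') : ℂ) = (inner ℂ x x' : ℂ) * (inner ℂ y y' : ℂ)
  dense_span : Dense ((Submodule.span ℂ {z | ∃ x y, z = tmul x y} : Submodule ℂ G) : Set G)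
  omul : (E →L[ℂ] E) → (F →L[ℂ] F) → (G →L[ℂ] G)
  omul_tmul : ∀ A B x y, omul A B (tmul x y) = tmul (A x) (B y)

end Tensor

section Classical

/-- The summand `x log (T / x)` of the homogeneous entropy of a family with total mass `T`. -/
def phi (T x : ℝ≥0∞) : ℝ≥0∞ :=
  ENNReal.ofReal (x.toReal * Real.log (T.toReal / x.toReal))

/-- The homogeneous Shannon entropy `∑ xᵢ log (T / xᵢ)`, `T = ∑ xᵢ`, of an extended
nonnegative family. -/
def Hc {ι : Type*} (x : ι → ℝ≥0∞) : ℝ≥0∞ := ∑' i, phi (∑' j, x j) (x i)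

theorem mul_log_div_add_le {T x : ℝ} (hx : 0 ≤ x) (hxT : x ≤ T) (a : ℝ) :
    x * Real.log (T / x) + x ≤ x * a + T * Real.exp (-a) := by
  rcases hx.eq_or_lt with rfl | hx
  · simpa using mul_nonneg hxT (Real.exp_pos _).le
  have hT : 0 < T := hx.trans_le hxT
  have h := Real.log_le_sub_one_of_pos (x := T * Real.exp (-a) / x) (by positivity)
  rw [Real.log_div (by positivity) hx.ne', Real.log_mul hT.ne' (Real.exp_pos _).ne',
    Real.log_exp] at h
  rw [Real.log_div hT.ne' hx.ne']
  have h2 := mul_le_mul_of_nonneg_left h hx.le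
  have h3 : x * (T * Real.exp (-a) / x - 1) = T * Real.exp (-a) - x := by
    field_simp
  nlinarith

theorem mul_log_div_nonneg {T x : ℝ} (hx : 0 ≤ x) (hxT : x ≤ T) :
    0 ≤ x * Real.log (T / x) := by
  rcases hx.eq_or_lt with rfl | hx
  · simp
  · exact mul_nonneg hx.le (Real.log_nonneg (by rwa [le_div_iff₀ hx, one_mul]))

@[simp] theorem phi_zero_right (T : ℝ≥0∞) : phi T 0 = 0 := by simp [phi]

theorem phi_ne_top (T x : ℝ≥0∞) : phi T x ≠ ∞ := ENNReal.ofReal_ne_top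

theorem phi_add_le {T x : ℝ≥0∞} (hT : T ≠ ∞) (hx : x ≤ T) {a : ℝ} (ha : 0 ≤ a) :
    phi T x + x ≤ x * ENNReal.ofReal a + T * ENNReal.ofReal (Real.exp (-a)) := by
  lift T to ℝ≥0 using hT
  lift x to ℝ≥0 using ne_top_of_le_ne_top ENNReal.coe_ne_top hx
  have hx' : (x : ℝ) ≤ T := by exact_mod_cast hx
  have h := ENNReal.ofReal_le_ofReal (mul_log_div_add_le x.coe_nonneg hx' a)
  rw [ENNReal.ofReal_add (mul_log_div_nonneg x.coe_nonneg hx') x.coe_nonneg,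
    ENNReal.ofReal_add (by positivity) (by positivity), ENNReal.ofReal_mul x.coe_nonneg,
    ENNReal.ofReal_mul T.coe_nonneg] at h
  rw [← ENNReal.ofReal_mul x.coe_nonneg] at h
  simpa [phi] using h

theorem mul_exp_neg_log {T d : ℝ≥0∞} (hT : T ≠ ∞) (hd : d ≤ T) (hd0 : d ≠ 0) :
    T * ENNReal.ofReal (Real.exp (-Real.log (T.toReal / d.toReal))) = d := by
  have hdt : d ≠ ∞ := ne_top_of_le_ne_top hT hd
  have hd1 : 0 < d.toReal := ENNReal.toReal_pos hd0 hdt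
  have hT1 : 0 < T.toReal := hd1.trans_le (ENNReal.toReal_mono hT hd)
  lift T to ℝ≥0 using hT
  lift d to ℝ≥0 using hdt
  rw [ENNReal.coe_toReal] at hd1 hT1
  rw [← Real.log_inv, Real.exp_log (by positivity), inv_div, ENNReal.coe_toReal,
    ENNReal.coe_toReal, ← ENNReal.ofReal_coe_nnreal, ← ENNReal.ofReal_mul T.coe_nonneg,
    mul_div_cancel₀ _ hT1.ne', ENNReal.ofReal_coe_nnreal]

theorem phi_add_le_log {T x d : ℝ≥0∞} (hT : T ≠ ∞) (hx : x ≤ T) (hd : d ≤ T) (hd0 : d ≠ 0) :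
    phi T x + x ≤ x * ENNReal.ofReal (Real.log (T.toReal / d.toReal)) + d := by
  have hdt : d ≠ ∞ := ne_top_of_le_ne_top hT hd
  have hd1 : 0 < d.toReal := ENNReal.toReal_pos hd0 hdt
  have hd2 : d.toReal ≤ T.toReal := ENNReal.toReal_mono hT hd
  have h := phi_add_le hT hx (a := Real.log (T.toReal / d.toReal))
    (Real.log_nonneg (by rwa [le_div_iff₀ hd1, one_mul]))
  rwa [mul_exp_neg_log hT hd hd0] at h

theorem mul_ofReal_log_eq_phi {T x : ℝ≥0∞} (hT : T ≠ ∞) (hx : x ≤ T) :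
    x * ENNReal.ofReal (Real.log (T.toReal / x.toReal)) = phi T x := by
  rw [phi, ENNReal.ofReal_mul ENNReal.toReal_nonneg,
    ENNReal.ofReal_toReal (ne_top_of_le_ne_top hT hx)]

theorem phi_add_phi_le {X Y x y : ℝ≥0∞} (hX : X ≠ ∞) (hY : Y ≠ ∞) (hx : x ≤ X) (hy : y ≤ Y) :
    phi X x + phi Y y ≤ phi (X + Y) (x + y) := by
  rcases eq_or_ne (x + y) 0 with h0 | h0
  · obtain ⟨rfl, rfl⟩ := add_eq_zero.mp h0
    simp
  have hXY : X + Y ≠ ∞ := ENNReal.add_ne_top.2 ⟨hX, hY⟩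
  have hxy : x + y ≤ X + Y := add_le_add hx hy
  have hd1 : 0 < (x + y).toReal := ENNReal.toReal_pos h0 (ne_top_of_le_ne_top hXY hxy)
  have hd2 : (x + y).toReal ≤ (X + Y).toReal := ENNReal.toReal_mono hXY hxy
  set a := Real.log ((X + Y).toReal / (x + y).toReal) with ha
  have ha0 : 0 ≤ a := Real.log_nonneg (by rwa [le_div_iff₀ hd1, one_mul])
  have h := add_le_add (phi_add_le hX hx ha0) (phi_add_le hY hy ha0)
  have he : (X + Y) * ENNReal.ofReal (Real.exp (-a)) = x + y := mul_exp_neg_log hXY hxy h0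
  have h2 : phi X x + phi Y y + (x + y) ≤ phi (X + Y) (x + y) + (x + y) := by
    calc phi X x + phi Y y + (x + y) = phi X x + x + (phi Y y + y) := by abel
      _ ≤ _ := h
      _ = (x + y) * ENNReal.ofReal a + (X + Y) * ENNReal.ofReal (Real.exp (-a)) := by ring
      _ = _ := by rw [he, mul_ofReal_log_eq_phi hXY hxy]
  exact (ENNReal.add_le_add_iff_right (ne_top_of_le_ne_top hXY hxy)).1 h2

theorem phi_mul_mul (r T x : ℝ≥0∞) : phi (r * T) (r * x) = ENNReal.ofReal r.toReal * phi T x := by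
  rw [phi, phi, ← ENNReal.ofReal_mul ENNReal.toReal_nonneg, ENNReal.toReal_mul,
    ENNReal.toReal_mul]
  rcases eq_or_ne r.toReal 0 with h | h
  · simp [h]
  · rw [mul_div_mul_left _ _ h, mul_assoc]

theorem phi_le_phi_add {T X x : ℝ≥0∞} (hT : T ≠ ∞) (hX : X ≤ T) (hx : x ≤ X) :
    phi T x ≤ phi X x + x * ENNReal.ofReal (Real.log (T.toReal / X.toReal)) := by
  rcases eq_or_ne x 0 with rfl | h0
  · simp
  have hXt := ne_top_of_le_ne_top hT hX
  have hxt := ne_top_of_le_ne_top hXt hx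
  have hx1 : 0 < x.toReal := ENNReal.toReal_pos h0 hxt
  have hx2 : x.toReal ≤ X.toReal := ENNReal.toReal_mono hXt hx
  have hX1 : 0 < X.toReal := hx1.trans_le hx2
  have hX2 : X.toReal ≤ T.toReal := ENNReal.toReal_mono hT hX
  have hT1 : 0 < T.toReal := hX1.trans_le hX2
  conv_rhs => rw [← ENNReal.ofReal_toReal hxt]
  rw [phi, phi, ENNReal.ofReal_toReal hxt]
  conv_rhs => enter [2, 1]; rw [← ENNReal.ofReal_toReal hxt]
  rw [← ENNReal.ofReal_mul hx1.le, ← ENNReal.ofReal_add (mul_log_div_nonneg hx1.le hx2)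
    (mul_nonneg hx1.le (Real.log_nonneg (by rwa [le_div_iff₀ hX1, one_mul])))]
  refine ENNReal.ofReal_le_ofReal (le_of_eq ?_)
  rw [Real.log_div hT1.ne' hx1.ne', Real.log_div hX1.ne' hx1.ne', Real.log_div hT1.ne' hX1.ne']
  ring

variable {ι κ : Type*}

theorem Hc_add_le {x y : ι → ℝ≥0∞} (hx : ∑' i, x i ≠ ∞) (hy : ∑' i, y i ≠ ∞) :
    Hc x + Hc y ≤ Hc (fun i => x i + y i) := by
  unfold Hc
  rw [← ENNReal.tsum_add]
  refine ENNReal.tsum_le_tsum fun i => ?_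
  rw [ENNReal.tsum_add]
  exact phi_add_phi_le hx hy (ENNReal.le_tsum i) (ENNReal.le_tsum i)

theorem Hc_mono {x y : ι → ℝ≥0∞} (hxy : ∀ i, x i ≤ y i) (hy : ∑' i, y i ≠ ∞) : Hc x ≤ Hc y := by
  have hx : ∑' i, x i ≠ ∞ := ne_top_of_le_ne_top hy (ENNReal.tsum_le_tsum hxy)
  have hz : ∑' i, (y i - x i) ≠ ∞ :=
    ne_top_of_le_ne_top hy (ENNReal.tsum_le_tsum fun i => tsub_le_self)
  have h := Hc_add_le hx hz
  simp only [add_tsub_cancel_of_le (hxy _)] at h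
  exact le_self_add.trans h

theorem Hc_mul_left (x : ι → ℝ≥0∞) {r : ℝ≥0∞} (hr : r ≠ ∞) :
    Hc (fun i => r * x i) = r * Hc x := by
  simp only [Hc, ENNReal.tsum_mul_left, phi_mul_mul, ENNReal.ofReal_toReal hr]

theorem tsum_phi_le_Hc_add {x : ι → ℝ≥0∞} {T : ℝ≥0∞} (hT : T ≠ ∞) (hx : ∑' i, x i ≤ T) :
    ∑' i, phi T (x i) ≤ Hc x + phi T (∑' i, x i) := by
  rw [← mul_ofReal_log_eq_phi hT hx, ← ENNReal.tsum_mul_right, Hc, ← ENNReal.tsum_add]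
  exact ENNReal.tsum_le_tsum fun i => phi_le_phi_add hT hx (ENNReal.le_tsum i)

/-- The mass outside a block bounds the entropy contribution of that block. -/
theorem phi_le_of_add_eq {T X Y : ℝ≥0∞} (hT : T ≠ ∞) (h : X + Y = T) : phi T X ≤ Y := by
  have hX : X ≤ T := h ▸ le_self_add
  have h1 := phi_add_le hT hX le_rfl
  simp only [ENNReal.ofReal_zero, mul_zero, zero_add, neg_zero, Real.exp_zero,
    ENNReal.ofReal_one, mul_one] at h1
  rw [show T = Y + X by rw [← h, add_comm]] at h1 ⊢
  exact (ENNReal.add_le_add_iff_right (ne_top_of_le_ne_top hT hX)).1 h1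

theorem Hc_sum_elim_le {x : ι → ℝ≥0∞} {y : κ → ℝ≥0∞} (hx : ∑' i, x i ≠ ∞) (hy : ∑' i, y i ≠ ∞)
    {K : ℝ} (hK : 0 ≤ K) :
    Hc (Sum.elim x y) ≤ Hc x + Hc y + (1 + ENNReal.ofReal K) * ∑' i, y i
      + (∑' i, x i + ∑' i, y i) * ENNReal.ofReal (Real.exp (-K)) := by
  set X := ∑' i, x i with hXdef
  set Y := ∑' i, y i with hYdef
  have hT : X + Y ≠ ∞ := ENNReal.add_ne_top.2 ⟨hx, hy⟩
  have hsum : ∑' i, Sum.elim x y i = X + Y := by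
    rw [ENNReal.summable.tsum_sum ENNReal.summable]; simp [hXdef, hYdef]
  have h0 : Hc (Sum.elim x y) = ∑' i, phi (X + Y) (x i) + ∑' i, phi (X + Y) (y i) := by
    rw [Hc, hsum, ENNReal.summable.tsum_sum ENNReal.summable]; simp
  have h1 := tsum_phi_le_Hc_add (x := x) hT le_self_add
  have h2 := tsum_phi_le_Hc_add (x := y) hT le_add_self
  have h3 : phi (X + Y) X ≤ Y := phi_le_of_add_eq hT rfl
  have h4 : phi (X + Y) Y ≤ Y * ENNReal.ofReal K + (X + Y) * ENNReal.ofReal (Real.exp (-K)) :=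
    le_self_add.trans (phi_add_le hT le_add_self hK)
  rw [h0]
  calc _ ≤ Hc x + Y + (Hc y + (Y * ENNReal.ofReal K + (X + Y) * ENNReal.ofReal (Real.exp (-K)))) :=
        add_le_add (h1.trans (by gcongr)) (h2.trans (by gcongr))
    _ = _ := by ring

theorem Hc_le_gibbs {y : ι → ℝ≥0∞} (hy : ∑' i, y i ≠ ∞) {a : ι → ℝ} (ha : ∀ i, 0 ≤ a i) :
    Hc y ≤ ∑' i, y i * ENNReal.ofReal (a i)
      + (∑' i, y i) * ∑' i, ENNReal.ofReal (Real.exp (-a i)) := by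
  rw [← ENNReal.tsum_mul_left, ← ENNReal.tsum_add]
  exact ENNReal.tsum_le_tsum fun i =>
    le_self_add.trans (phi_add_le hy (ENNReal.le_tsum i) (ha i))

/-- Mixing with a doubly substochastic matrix, stochastic in one direction, does not
decrease the entropy. -/
theorem Hc_le_of_mixing {x : ι → ℝ≥0∞} {d : κ → ℝ≥0∞} (p : ι → κ → ℝ≥0∞)
    (hp1 : ∀ i, x i ≠ 0 → ∑' k, p i k = 1) (hp2 : ∀ k, ∑' i, p i k ≤ 1)
    (hd : ∀ k, d k = ∑' i, p i k * x i) (hT : ∑' k, d k ≠ ∞) : Hc x ≤ Hc d := by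
  have hsum : ∑' i, x i = ∑' k, d k := by
    simp only [hd]
    rw [ENNReal.tsum_comm]
    refine tsum_congr fun i => ?_
    rw [ENNReal.tsum_mul_right]
    by_cases h : x i = 0
    · simp [h]
    · rw [hp1 i h, one_mul]
  set T := ∑' k, d k with hTdef
  have key : ∀ k, ∑' i, p i k * phi T (x i) ≤ phi T (d k) := by
    intro k
    have hdT : d k ≤ T := ENNReal.le_tsum k
    have hdt : d k ≠ ∞ := ne_top_of_le_ne_top hT hdT
    by_cases h0 : d k = 0
    · have h := h0
      rw [hd k, ENNReal.tsum_eq_zero] at h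
      refine (le_of_eq (ENNReal.tsum_eq_zero.2 fun i => ?_)).trans zero_le
      rcases mul_eq_zero.1 (h i) with h | h <;> simp [h]
    refine (ENNReal.add_le_add_iff_right hdt).1 ?_
    calc ∑' i, p i k * phi T (x i) + d k
        = ∑' i, p i k * (phi T (x i) + x i) := by
          conv_lhs => rw [hd k]
          rw [← ENNReal.tsum_add]
          exact tsum_congr fun i => (mul_add _ _ _).symm
      _ ≤ ∑' i, p i k * (x i * ENNReal.ofReal (Real.log (T.toReal / (d k).toReal)) + d k) := by
          refine ENNReal.tsum_le_tsum fun i => mul_le_mul_right ?_ _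
          exact phi_add_le_log hT (hsum ▸ ENNReal.le_tsum i) hdT h0
      _ = (∑' i, p i k * x i) * ENNReal.ofReal (Real.log (T.toReal / (d k).toReal))
            + (∑' i, p i k) * d k := by
          rw [← ENNReal.tsum_mul_right, ← ENNReal.tsum_mul_right, ← ENNReal.tsum_add]
          exact tsum_congr fun i => by ring
      _ ≤ phi T (d k) + d k := by
          rw [← hd k, mul_ofReal_log_eq_phi hT hdT]
          gcongr
          exact (mul_le_mul_left (hp2 k) _).trans (one_mul _).le
  unfold Hc
  rw [hsum]
  calc ∑' i, phi T (x i) = ∑' i, ∑' k, p i k * phi T (x i) := by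
        refine tsum_congr fun i => ?_
        rw [ENNReal.tsum_mul_right]
        by_cases h : x i = 0
        · simp [h]
        · rw [hp1 i h, one_mul]
    _ = ∑' k, ∑' i, p i k * phi T (x i) := ENNReal.tsum_comm
    _ ≤ _ := ENNReal.tsum_le_tsum key

theorem clEntropy_eq_Hc {x : ι → ℝ} (hx : ∀ i, 0 ≤ x i) (hs : Summable x) :
    clEntropy x = Hc (fun i => ENNReal.ofReal (x i)) := by
  have hX : (∑' i, ENNReal.ofReal (x i)).toReal = ∑' i, x i := by
    rw [← ENNReal.ofReal_tsum_of_nonneg hx hs, ENNReal.toReal_ofReal (tsum_nonneg hx)]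
  rw [clEntropy, Hc, ← ENNReal.tsum_mul_left]
  refine tsum_congr fun i => ?_
  rw [phi, hX, ENNReal.toReal_ofReal (hx i), ← ENNReal.ofReal_mul (tsum_nonneg hx)]
  congr 1
  set X := ∑' i, x i
  rcases eq_or_ne X 0 with h | h
  · simp [h]
  rw [Real.negMulLog, ← inv_div (x i) X, Real.log_inv]
  field_simp

theorem Hc_eq_of_fintype [Fintype ι] {x : ι → ℝ} (hx : ∀ i, 0 ≤ x i) :
    Hc (fun i => ENNReal.ofReal (x i))
      = ENNReal.ofReal (∑ i, Real.negMulLog (x i) - Real.negMulLog (∑ i, x i)) := by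
  have hle : ∀ i, x i ≤ ∑ i, x i := fun i =>
    Finset.single_le_sum (fun j _ => hx j) (Finset.mem_univ i)
  have hX : (∑' i, ENNReal.ofReal (x i)).toReal = ∑ i, x i := by
    rw [tsum_fintype, ← ENNReal.ofReal_sum_of_nonneg fun i _ => hx i,
      ENNReal.toReal_ofReal (Finset.sum_nonneg fun i _ => hx i)]
  rw [Hc, tsum_fintype]
  simp only [phi, hX, ENNReal.toReal_ofReal (hx _)]
  rw [← ENNReal.ofReal_sum_of_nonneg fun i _ => mul_log_div_nonneg (hx i) (hle i)]
  congr 1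
  set X := ∑ i, x i with hXd
  have : Real.negMulLog X = ∑ i, -(x i * Real.log X) := by
    rw [Finset.sum_neg_distrib, ← Finset.sum_mul, ← hXd, Real.negMulLog, neg_mul]
  rw [this, ← Finset.sum_sub_distrib]
  refine Finset.sum_congr rfl fun i _ => ?_
  rcases (hx i).eq_or_lt with h | h
  · simp [← h]
  rw [Real.log_div (h.trans_le (hle i)).ne' h.ne', Real.negMulLog]
  ring

end Classical

set_option linter.unusedSectionVars false

section Hilbert

variable {E F : Type*}
variable [NormedAddCommGroup E] [InnerProductSpace ℂ E] [CompleteSpace E]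
variable [NormedAddCommGroup F] [InnerProductSpace ℂ F] [CompleteSpace F]
variable {ι κ : Type*}

theorem enorm_sq_eq_ofReal {G : Type*} [SeminormedAddCommGroup G] (x : G) :
    ‖x‖ₑ ^ 2 = ENNReal.ofReal (‖x‖ ^ 2) := by
  rw [ENNReal.ofReal_pow (norm_nonneg x), ofReal_norm]

theorem enorm_inner_symm (x y : E) : ‖(inner ℂ x y : ℂ)‖ₑ = ‖(inner ℂ y x : ℂ)‖ₑ := by
  rw [← ofReal_norm, ← ofReal_norm, norm_inner_symm]

/-- A Parseval frame: `∑ₖ |⟪wₖ, x⟫|² = ‖x‖²` for all `x`. -/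
def IsFrame (w : κ → E) : Prop := ∀ x : E, ∑' k, ‖(inner ℂ (w k) x : ℂ)‖ₑ ^ 2 = ‖x‖ₑ ^ 2

theorem IsONB.isFrame {s : Set E} (hs : IsONB s) : IsFrame ((↑) : s → E) := by
  intro x
  have hsp : ⊤ ≤ (Submodule.span ℂ (Set.range ((↑) : s → E))).topologicalClosure := by
    rw [Subtype.range_coe, (Submodule.dense_iff_topologicalClosure_eq_top).1 hs.2]
  have h := (HilbertBasis.mk hs.1 hsp).hasSum_inner_mul_inner x x
  simp only [HilbertBasis.coe_mk] at h
  have h2 : HasSum (fun v : s => ‖(inner ℂ (v : E) x : ℂ)‖ ^ 2) (‖x‖ ^ 2) := by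
    have := Complex.hasSum_re h
    rw [inner_self_eq_norm_sq_to_K] at this
    convert this using 1
    · funext v
      rw [← inner_conj_symm x (v : E), Complex.conj_mul', ← Complex.ofReal_pow, Complex.ofReal_re]
    · norm_cast
  simp only [enorm_sq_eq_ofReal]
  rw [← ENNReal.ofReal_tsum_of_nonneg (fun v => by positivity) h2.summable, h2.tsum_eq]

theorem IsFrame.tsum_enorm_map {w : κ → E} (hw : IsFrame w) {u : ι → F} (hu : IsFrame u)
    (T : E →L[ℂ] F) :
    ∑' k, ‖T (w k)‖ₑ ^ 2 = ∑' i, ‖ContinuousLinearMap.adjoint T (u i)‖ₑ ^ 2 := by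
  simp only [← hu (T _), ← hw (ContinuousLinearMap.adjoint T _)]
  rw [ENNReal.tsum_comm]
  refine tsum_congr fun i => tsum_congr fun k => ?_
  rw [ContinuousLinearMap.adjoint_inner_right, enorm_inner_symm]

/-- The trace of a positive operator in the fixed orthonormal basis. -/
def ptr (A : E →L[ℂ] E) : ℝ≥0∞ := ∑' v : stdONB E, ENNReal.ofReal (qf A v)

theorem isONB_stdONB : IsONB (stdONB E) := (exists_isONB E).choose_spec

theorem qf_nonneg {A : E →L[ℂ] E} (hA : A.IsPositive) (x : E) : 0 ≤ qf A x :=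
  hA.re_inner_nonneg_right x

/-- Existence of a self-adjoint square root. -/
theorem exists_sqrt {A : E →L[ℂ] E} (hA : A.IsPositive) :
    ∃ R : E →L[ℂ] E, ContinuousLinearMap.adjoint R = R ∧ R ∘L R = A ∧
      ∀ x, qf A x = ‖R x‖ ^ 2 := by
  have h0 : 0 ≤ A := (ContinuousLinearMap.nonneg_iff_isPositive A).2 hA
  have hR : ContinuousLinearMap.adjoint (CFC.sqrt A) = CFC.sqrt A :=
    ((ContinuousLinearMap.nonneg_iff_isPositive _).1 (CFC.sqrt_nonneg A)).isSelfAdjoint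
  have h2 : CFC.sqrt A ∘L CFC.sqrt A = A := CFC.sqrt_mul_sqrt_self A h0
  refine ⟨CFC.sqrt A, hR, h2, fun x => ?_⟩
  generalize CFC.sqrt A = R at hR h2
  rw [← h2, qf, ContinuousLinearMap.comp_apply, ← ContinuousLinearMap.adjoint_inner_left, hR,
    inner_self_eq_norm_sq_to_K]
  norm_cast

theorem IsFrame.tsum_qf {A : E →L[ℂ] E} (hA : A.IsPositive) {w : κ → E} (hw : IsFrame w) :
    ∑' k, ENNReal.ofReal (qf A (w k)) = ptr A := by
  obtain ⟨R, hR, -, hq⟩ := exists_sqrt hA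
  have h := hw.tsum_enorm_map isONB_stdONB.isFrame R
  simpa only [ptr, hq, ← enorm_sq_eq_ofReal, hR] using h

theorem summable_of_tsum_ofReal_ne_top {x : ι → ℝ} (hx : ∀ i, 0 ≤ x i)
    (h : ∑' i, ENNReal.ofReal (x i) ≠ ∞) : Summable x := by
  have h1 := ENNReal.summable_toReal h
  simpa only [ENNReal.toReal_ofReal (hx _)] using h1

theorem clEntropy_qf {A : E →L[ℂ] E} (hA : A.IsPositive) (ht : ptr A ≠ ∞) {s : Set E}
    (hs : IsONB s) :
    clEntropy (fun v : s => qf A v) = Hc (fun v : s => ENNReal.ofReal (qf A v)) := by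
  refine clEntropy_eq_Hc (fun v => qf_nonneg hA v)
    (summable_of_tsum_ofReal_ne_top (fun v => qf_nonneg hA v) ?_)
  rwa [hs.isFrame.tsum_qf hA]

theorem qEntropy_le {A : E →L[ℂ] E} (hA : A.IsPositive) (ht : ptr A ≠ ∞) {s : Set E}
    (hs : IsONB s) : qEntropy A ≤ Hc (fun v : s => ENNReal.ofReal (qf A v)) := by
  rw [← clEntropy_qf hA ht hs]
  exact iInf₂_le s hs

theorem le_qEntropy {A : E →L[ℂ] E} (hA : A.IsPositive) (ht : ptr A ≠ ∞) {c : ℝ≥0∞}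
    (h : ∀ s : Set E, IsONB s → c ≤ Hc (fun v : s => ENNReal.ofReal (qf A v))) :
    c ≤ qEntropy A :=
  le_iInf₂ fun s hs => by rw [clEntropy_qf hA ht hs]; exact h s hs

theorem exists_isONB_Hc_le {A : E →L[ℂ] E} (hA : A.IsPositive) (ht : ptr A ≠ ∞)
    {c : ℝ≥0∞} (hc : qEntropy A < c) :
    ∃ s : Set E, IsONB s ∧ Hc (fun v : s => ENNReal.ofReal (qf A v)) < c := by
  simp only [qEntropy, iInf_lt_iff] at hc
  obtain ⟨s, hs, h⟩ := hc
  exact ⟨s, hs, by rwa [clEntropy_qf hA ht hs] at h⟩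

theorem isCompactOperator_sum_rankOne (Φ : Finset ι) (b c : ι → E) :
    IsCompactOperator (∑ i ∈ Φ, InnerProductSpace.rankOne ℂ (b i) (c i) : E →L[ℂ] E) := by
  induction Φ using Finset.induction_on with
  | empty => simpa using isCompactOperator_zero
  | insert a Φ ha ih =>
    rw [Finset.sum_insert ha]
    have h1 : IsCompactOperator (InnerProductSpace.rankOne ℂ (b a) (c a) : E →L[ℂ] E) := by
      have h2 : IsCompactOperator (innerSL ℂ (c a)) :=
        isCompactOperator_of_locallyCompactSpace_dom _
      exact h2.clm_comp (ContinuousLinearMap.toSpanSingleton ℂ (b a))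
    exact h1.add ih

end Hilbert

section Spectral

variable {E F : Type*}
variable [NormedAddCommGroup E] [InnerProductSpace ℂ E] [CompleteSpace E]
variable [NormedAddCommGroup F] [InnerProductSpace ℂ F] [CompleteSpace F]
variable {ι κ : Type*}

theorem isCompactOperator_of_tsum_enorm_sq {R : E →L[ℂ] E}
    (hR : ContinuousLinearMap.adjoint R = R) {s : Set E} (hs : IsONB s)
    (h : ∑' v : s, ‖R v‖ₑ ^ 2 ≠ ∞) : IsCompactOperator R := by
  let S : Finset s → E →L[ℂ] E := fun Φ =>
    ∑ v ∈ Φ, InnerProductSpace.rankOne ℂ (v : E) (R v)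
  have hbound : ∀ Φ : Finset s, ‖S Φ - R‖ₑ ^ 2 ≤ ∑' v : {v // v ∉ Φ}, ‖R v‖ₑ ^ 2 := by
    intro Φ
    set c := ∑' v : {v // v ∉ Φ}, ‖R v‖ₑ ^ 2 with hc
    have hct : c ≠ ∞ := ne_top_of_le_ne_top h
      (ENNReal.tsum_comp_le_tsum_of_injective Subtype.val_injective (fun v : s => ‖R v‖ₑ ^ 2))
    have hin : ∀ (v : s) (x : E), (inner ℂ (v : E) ((S Φ - R) x) : ℂ)
        = if v ∈ Φ then 0 else -inner ℂ (R v) x := by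
      intro v x
      have h1 : (inner ℂ (v : E) (R x) : ℂ) = inner ℂ (R v) x := by
        rw [← ContinuousLinearMap.adjoint_inner_left, hR]
      simp only [S, sub_apply, inner_sub_right, h1,
        sum_apply, InnerProductSpace.rankOne_apply, inner_sum,
        inner_smul_right, orthonormal_iff_ite.1 hs.1]
      split_ifs with hv <;> simp [hv]
    have hx : ∀ x : E, ‖(S Φ - R) x‖ₑ ^ 2 ≤ c * ‖x‖ₑ ^ 2 := by
      intro x
      rw [← hs.isFrame, hc, ← ENNReal.tsum_mul_right]
      have : ∀ v : s, ‖(inner ℂ (v : E) ((S Φ - R) x) : ℂ)‖ₑ ^ 2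
          = Set.indicator {v | v ∉ Φ} (fun v : s => ‖(inner ℂ (R v) x : ℂ)‖ₑ ^ 2) v := by
        intro v
        rw [hin]
        by_cases hv : v ∈ Φ <;> simp [hv]
      rw [tsum_congr this, ← tsum_subtype]
      refine ENNReal.tsum_le_tsum fun v => ?_
      rw [← mul_pow]
      gcongr
      rw [← ofReal_norm, ← ofReal_norm, ← ofReal_norm,
        ← ENNReal.ofReal_mul (norm_nonneg _)]
      exact ENNReal.ofReal_le_ofReal (norm_inner_le_norm _ _)
    have hop : ‖S Φ - R‖ ≤ Real.sqrt c.toReal := by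
      refine ContinuousLinearMap.opNorm_le_bound _ (Real.sqrt_nonneg _) fun x => ?_
      have h2 := ENNReal.toReal_mono (by finiteness) (hx x)
      simp only [ENNReal.toReal_mul, ENNReal.toReal_pow, toReal_enorm] at h2
      refine le_of_sq_le_sq ?_ (by positivity)
      rwa [mul_pow, Real.sq_sqrt ENNReal.toReal_nonneg]
    rw [enorm_sq_eq_ofReal, ← ENNReal.ofReal_toReal hct]
    refine ENNReal.ofReal_le_ofReal ?_
    calc ‖S Φ - R‖ ^ 2 ≤ Real.sqrt c.toReal ^ 2 := by gcongr
      _ = c.toReal := Real.sq_sqrt ENNReal.toReal_nonneg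
  have htend : Tendsto S atTop (𝓝 R) := by
    have h1 : Tendsto (fun Φ => ‖S Φ - R‖ₑ ^ 2) atTop (𝓝 0) :=
      tendsto_of_tendsto_of_tendsto_of_le_of_le tendsto_const_nhds
        (ENNReal.tendsto_tsum_compl_atTop_zero h) (fun _ => zero_le) hbound
    have h2 : Tendsto (fun Φ => ‖S Φ - R‖ ^ 2) atTop (𝓝 0) := by
      have := (ENNReal.tendsto_toReal ENNReal.zero_ne_top).comp h1
      simpa [Function.comp_def] using this
    rw [tendsto_iff_norm_sub_tendsto_zero]
    have := (Real.continuous_sqrt.tendsto 0).comp h2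
    simpa [Function.comp_def] using this
  exact isCompactOperator_of_tendsto htend
    (Eventually.of_forall fun Φ => isCompactOperator_sum_rankOne Φ _ _)

theorem isCompactOperator_of_ptr {A : E →L[ℂ] E} (hA : A.IsPositive) (ht : ptr A ≠ ∞) :
    IsCompactOperator A := by
  obtain ⟨R, hR, hRR, hq⟩ := exists_sqrt hA
  have h : IsCompactOperator R := isCompactOperator_of_tsum_enorm_sq hR isONB_stdONB (by
    simpa only [ptr, hq, ← enorm_sq_eq_ofReal] using ht)
  rw [← hRR]
  exact h.clm_comp R

/-- Spectral theorem: a positive operator of finite trace has an orthonormal eigenbasis. -/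
theorem exists_eigenbasis {A : E →L[ℂ] E} (hA : A.IsPositive) (ht : ptr A ≠ ∞) :
    ∃ s : Set E, IsONB s ∧ ∀ v ∈ s, A v = (qf A v : ℂ) • v := by
  have hsym : (A : E →ₗ[ℂ] E).IsSymmetric := hA.isSymmetric
  have hbot := ContinuousLinearMap.orthogonalComplement_iSup_eigenspaces_eq_bot
    (isCompactOperator_of_ptr hA ht) hsym
  let W : ℂ → Submodule ℂ E := fun μ => Module.End.eigenspace (A : Module.End ℂ E) μ
  have hcl : ∀ μ, IsClosed (W μ : Set E) := fun μ => by
    have : (W μ : Set E) = {x | A x = μ • x} := by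
      ext x; simp [W]
    rw [this]
    exact isClosed_eq A.continuous (continuous_const_smul μ)
  have hcs : ∀ μ, CompleteSpace (W μ) := fun μ => (hcl μ).completeSpace_coe
  choose t ht' using fun μ => @exists_isONB (W μ) _ _ (hcs μ)
  let s : Set E := {x | ∃ μ, ∃ y ∈ t μ, (y : E) = x}
  have heig : ∀ v ∈ s, ∃ μ : ℂ, A v = μ • v := by
    rintro v ⟨μ, y, hy, rfl⟩
    exact ⟨μ, Module.End.mem_eigenspace_iff.1 y.2⟩
  have horth : Orthonormal ℂ ((↑) : s → E) := by
    rw [orthonormal_subtype_iff_ite]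
    rintro _ ⟨μ, y, hy, rfl⟩ _ ⟨μ', y', hy', rfl⟩
    by_cases hμ : μ = μ'
    · subst hμ
      have := orthonormal_subtype_iff_ite.1 (ht' μ).1 y hy y' hy'
      rw [Submodule.coe_inner] at this
      rw [this]
      by_cases hy : y = y'
      · rw [if_pos hy, if_pos (congrArg _ hy)]
      · rw [if_neg hy, if_neg fun h => hy (Subtype.ext h)]
    · have h0 := hsym.orthogonalFamily_eigenspaces hμ y y'
      have h0 : (inner ℂ (y : E) (y' : E) : ℂ) = 0 := h0
      rw [h0, if_neg]
      intro heq
      rw [← heq, inner_self_eq_zero] at h0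
      have h1 := (ht' μ).1.1 ⟨y, hy⟩
      have h2 : y = 0 := Subtype.ext h0
      simp [h2] at h1
  refine ⟨s, ⟨horth, ?_⟩, ?_⟩
  · rw [Submodule.dense_iff_topologicalClosure_eq_top,
      Submodule.topologicalClosure_eq_top_iff, eq_bot_iff, ← hbot]
    rw [← Submodule.orthogonal_closure (Submodule.span ℂ s)]
    refine Submodule.orthogonal_le (iSup_le fun μ x hx => ?_)
    have hd : (⟨x, hx⟩ : W μ) ∈ closure (Submodule.span ℂ (t μ) : Set (W μ)) := (ht' μ).2 _
    have hsub : Set.MapsTo ((↑) : W μ → E) (Submodule.span ℂ (t μ)) (Submodule.span ℂ s) := by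
      intro y hy
      have h1 : (W μ).subtype y ∈ (Submodule.span ℂ (t μ)).map (W μ).subtype :=
        Submodule.mem_map_of_mem hy
      rw [Submodule.map_span] at h1
      refine Submodule.span_mono ?_ h1
      rintro _ ⟨z, hz, rfl⟩
      exact ⟨μ, z, hz, rfl⟩
    exact map_mem_closure continuous_subtype_val hd hsub
  · intro v hv
    obtain ⟨μ, hμ⟩ := heig v hv
    have hn : (inner ℂ v v : ℂ) = 1 := by
      have := orthonormal_subtype_iff_ite.1 horth v hv v hv
      simpa using this
    have him : (inner ℂ v (A v) : ℂ) = μ := by rw [hμ, inner_smul_right, hn, mul_one]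
    have hre : ((qf A v : ℝ) : ℂ) = inner ℂ v (A v) := by
      have := hA.inner_nonneg_right v
      exact (Complex.eq_re_of_ofReal_le (r := 0) (by simpa using this)).symm
    rw [hre, him, hμ]

end Spectral

section Decomposition

variable {E F G : Type*}
variable [NormedAddCommGroup E] [InnerProductSpace ℂ E] [CompleteSpace E]
variable [NormedAddCommGroup F] [InnerProductSpace ℂ F] [CompleteSpace F]
variable [NormedAddCommGroup G] [InnerProductSpace ℂ G] [CompleteSpace G]
variable {ι κ : Type*}

theorem ptr_eq_of_decomp {B : F →L[ℂ] F} {y : κ → F}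
    (hy : ∀ x, ENNReal.ofReal (qf B x) = ∑' k, ‖(inner ℂ (y k) x : ℂ)‖ₑ ^ 2) :
    ptr B = ∑' k, ‖y k‖ₑ ^ 2 := by
  simp only [ptr, hy, ← isONB_stdONB.isFrame (y _)]
  rw [ENNReal.tsum_comm]
  simp only [enorm_inner_symm (y _)]

/-- If `y` decomposes `B` as `∑ₖ |yₖ⟩⟨yₖ|` and `g` are orthonormal eigenvectors of `B`, the
coefficients `|⟪g, y⟫|² / μ_g` are substochastic in `g`. -/
theorem tsum_inner_sq_div_le_one {B : F →L[ℂ] F} {s : Set F} (hs : Orthonormal ℂ ((↑) : s → F))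
    (hse : ∀ v ∈ s, B v = (qf B v : ℂ) • v) (hB : B.IsPositive) {y : F}
    (hy : ∀ x, ‖(inner ℂ y x : ℂ)‖ ^ 2 ≤ qf B x) :
    ∑' g : s, ENNReal.ofReal (‖(inner ℂ (g : F) y : ℂ)‖ ^ 2 / qf B g) ≤ 1 := by
  rw [ENNReal.tsum_eq_iSup_sum]
  refine iSup_le fun Φ => ?_
  have hnn : ∀ g : s, 0 ≤ ‖(inner ℂ (g : F) y : ℂ)‖ ^ 2 / qf B g :=
    fun g => div_nonneg (by positivity) (qf_nonneg hB _)
  rw [← ENNReal.ofReal_sum_of_nonneg fun g _ => hnn g]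
  set r := ∑ g ∈ Φ, ‖(inner ℂ (g : F) y : ℂ)‖ ^ 2 / qf B g with hr
  let c : s → ℂ := fun g => inner ℂ (g : F) y / (qf B g : ℂ)
  let z : F := ∑ g ∈ Φ, c g • (g : F)
  have hyz : (inner ℂ y z : ℂ) = (r : ℂ) := by
    simp only [z, inner_sum, inner_smul_right, hr, Complex.ofReal_sum, c]
    refine Finset.sum_congr rfl fun g _ => ?_
    rw [← inner_conj_symm y (g : F), div_mul_eq_mul_div, Complex.mul_conj']
    push_cast
    rfl
  have hBz : B z = ∑ g ∈ Φ, ((qf B g : ℂ) * c g) • (g : F) := by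
    simp only [z, map_sum, map_smul, hse _ (Subtype.coe_prop _), smul_smul, mul_comm]
  have hq : qf B z = r := by
    have : (inner ℂ z (B z) : ℂ) = (r : ℂ) := by
      rw [hBz]
      simp only [z]
      rw [hs.inner_sum]
      simp only [hr, Complex.ofReal_sum]
      refine Finset.sum_congr rfl fun g _ => ?_
      simp only [c, map_div₀, Complex.conj_ofReal]
      by_cases h0 : qf B g = 0
      · simp [h0]
      · have h0' : (qf B g : ℂ) ≠ 0 := by exact_mod_cast h0
        rw [mul_div_cancel₀ _ h0', div_mul_eq_mul_div, Complex.conj_mul']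
        push_cast
        rfl
    rw [qf, this, Complex.ofReal_re]
  have hle := hy z
  have hr0 : 0 ≤ r := Finset.sum_nonneg fun g _ => hnn g
  rw [hyz, hq, Complex.norm_real, Real.norm_of_nonneg hr0] at hle
  rw [← ENNReal.ofReal_one]
  exact ENNReal.ofReal_le_ofReal (by nlinarith)

theorem qEntropy_le_of_decomp {B : F →L[ℂ] F} (hB : B.IsPositive) {y : κ → F}
    (hy : ∀ x, ENNReal.ofReal (qf B x) = ∑' k, ‖(inner ℂ (y k) x : ℂ)‖ₑ ^ 2)
    (ht : ∑' k, ‖y k‖ₑ ^ 2 ≠ ∞) : qEntropy B ≤ Hc (fun k => ‖y k‖ₑ ^ 2) := by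
  have htr : ptr B ≠ ∞ := by rwa [ptr_eq_of_decomp hy]
  obtain ⟨s, hs, hse⟩ := exists_eigenbasis hB htr
  have hyk : ∀ k x, ‖(inner ℂ (y k) x : ℂ)‖ ^ 2 ≤ qf B x := fun k x => by
    rw [← ENNReal.ofReal_le_ofReal_iff (qf_nonneg hB x), ← enorm_sq_eq_ofReal, hy]
    exact ENNReal.le_tsum k
  refine (qEntropy_le hB htr hs).trans (Hc_le_of_mixing
    (p := fun g k => ENNReal.ofReal (‖(inner ℂ (g : F) (y k) : ℂ)‖ ^ 2 / qf B g))
    ?_ (fun k => tsum_inner_sq_div_le_one hs.1 hse hB (hyk k)) ?_ ht)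
  · intro g hg
    have hpos : 0 < qf B g := by simpa using hg
    simp only [ENNReal.ofReal_div_of_pos hpos]
    simp only [div_eq_mul_inv]
    rw [ENNReal.tsum_mul_right]
    simp only [← enorm_sq_eq_ofReal, enorm_inner_symm (g : F)]
    rw [← hy]
    exact ENNReal.mul_inv_cancel hg ENNReal.ofReal_ne_top
  · intro k
    rw [← hs.isFrame (y k)]
    refine tsum_congr fun g => ?_
    have hq := qf_nonneg hB (g : F)
    rw [← ENNReal.ofReal_mul (div_nonneg (by positivity) hq), enorm_sq_eq_ofReal]
    congr 1
    by_cases h0 : qf B g = 0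
    · have := hyk k g
      rw [norm_inner_symm, h0] at this
      rw [h0, mul_zero]
      exact le_antisymm this (by positivity)
    · rw [div_mul_cancel₀ _ h0]

/-- The conjugation `T A T*`. -/
abbrev conj (T : E →L[ℂ] F) (A : E →L[ℂ] E) : F →L[ℂ] F :=
  T ∘L A ∘L ContinuousLinearMap.adjoint T

theorem isPositive_conj {A : E →L[ℂ] E} (hA : A.IsPositive) (T : E →L[ℂ] F) :
    (conj T A).IsPositive := hA.conj_adjoint T

theorem qf_conj (A : E →L[ℂ] E) (T : E →L[ℂ] F) (x : F) :
    qf (conj T A) x = qf A (ContinuousLinearMap.adjoint T x) := by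
  simp only [qf, conj, ContinuousLinearMap.comp_apply, ContinuousLinearMap.adjoint_inner_left]

theorem conj_decomp {A R : E →L[ℂ] E} (hR : ContinuousLinearMap.adjoint R = R)
    (hq : ∀ x, qf A x = ‖R x‖ ^ 2) (T : E →L[ℂ] F) {w : κ → E} (hw : IsFrame w) (x : F) :
    ENNReal.ofReal (qf (conj T A) x) = ∑' k, ‖(inner ℂ (T (R (w k))) x : ℂ)‖ₑ ^ 2 := by
  rw [qf_conj, hq, ← enorm_sq_eq_ofReal, ← hw]
  refine tsum_congr fun k => ?_
  rw [← ContinuousLinearMap.adjoint_inner_left, hR, ContinuousLinearMap.adjoint_inner_right]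

/-- The diagonal entropy of `A` in any Parseval frame dominates its quantum entropy. -/
theorem qEntropy_le_Hc_frame {A : E →L[ℂ] E} (hA : A.IsPositive) (ht : ptr A ≠ ∞) {w : κ → E}
    (hw : IsFrame w) : qEntropy A ≤ Hc (fun k => ENNReal.ofReal (qf A (w k))) := by
  obtain ⟨R, hR, -, hq⟩ := exists_sqrt hA
  have h : ∀ x, ENNReal.ofReal (qf A x) = ∑' k, ‖(inner ℂ (R (w k)) x : ℂ)‖ₑ ^ 2 := by
    intro x
    rw [hq, ← enorm_sq_eq_ofReal, ← hw]
    refine tsum_congr fun k => ?_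
    rw [← ContinuousLinearMap.adjoint_inner_left, hR]
  have := qEntropy_le_of_decomp hA h (by rwa [← ptr_eq_of_decomp h])
  simpa only [enorm_sq_eq_ofReal, ← hq] using this

theorem ptr_conj_add_le {A : E →L[ℂ] E} (hA : A.IsPositive) {T : E →L[ℂ] F} {W : E →L[ℂ] G}
    (hTW : ∀ x, ‖T x‖ ^ 2 + ‖W x‖ ^ 2 ≤ ‖x‖ ^ 2) :
    ptr (conj T A) + ptr (conj W A) ≤ ptr A := by
  obtain ⟨R, hR, -, hq⟩ := exists_sqrt hA
  rw [ptr_eq_of_decomp (conj_decomp hR hq T isONB_stdONB.isFrame),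
    ptr_eq_of_decomp (conj_decomp hR hq W isONB_stdONB.isFrame), ← ENNReal.tsum_add, ptr]
  refine ENNReal.tsum_le_tsum fun v => ?_
  rw [hq, enorm_sq_eq_ofReal, enorm_sq_eq_ofReal, ← ENNReal.ofReal_add (by positivity)
    (by positivity)]
  exact ENNReal.ofReal_le_ofReal (hTW _)

/-- Superadditivity of the quantum entropy along a pair of jointly contractive operators. -/
theorem qEntropy_conj_add_le {A : E →L[ℂ] E} (hA : A.IsPositive) (ht : ptr A ≠ ∞)
    {T : E →L[ℂ] F} {W : E →L[ℂ] G} (hTW : ∀ x, ‖T x‖ ^ 2 + ‖W x‖ ^ 2 ≤ ‖x‖ ^ 2) :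
    qEntropy (conj T A) + qEntropy (conj W A) ≤ qEntropy A := by
  obtain ⟨R, hR, -, hq⟩ := exists_sqrt hA
  have hsum := ptr_conj_add_le hA hTW
  refine le_qEntropy hA ht fun s hs => ?_
  have hT := conj_decomp hR hq T hs.isFrame
  have hW := conj_decomp hR hq W hs.isFrame
  have htT : ∑' v : s, ‖T (R v)‖ₑ ^ 2 ≠ ∞ := by
    rw [← ptr_eq_of_decomp hT]
    exact ne_top_of_le_ne_top ht (le_self_add.trans hsum)
  have htW : ∑' v : s, ‖W (R v)‖ₑ ^ 2 ≠ ∞ := by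
    rw [← ptr_eq_of_decomp hW]
    exact ne_top_of_le_ne_top ht (le_add_self.trans hsum)
  calc qEntropy (conj T A) + qEntropy (conj W A)
      ≤ Hc (fun v : s => ‖T (R v)‖ₑ ^ 2) + Hc (fun v : s => ‖W (R v)‖ₑ ^ 2) :=
        add_le_add (qEntropy_le_of_decomp (isPositive_conj hA T) hT htT)
          (qEntropy_le_of_decomp (isPositive_conj hA W) hW htW)
    _ ≤ Hc (fun v : s => ‖T (R v)‖ₑ ^ 2 + ‖W (R v)‖ₑ ^ 2) := Hc_add_le htT htW
    _ ≤ _ := by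
      refine Hc_mono (fun v => ?_) (by rwa [hs.isFrame.tsum_qf hA])
      rw [hq, enorm_sq_eq_ofReal, enorm_sq_eq_ofReal, ← ENNReal.ofReal_add (by positivity)
        (by positivity)]
      exact ENNReal.ofReal_le_ofReal (hTW _)

theorem ptr_conj_le {A : E →L[ℂ] E} (hA : A.IsPositive) {T : E →L[ℂ] F}
    (hT : ∀ x, ‖T x‖ ^ 2 ≤ ‖x‖ ^ 2) : ptr (conj T A) ≤ ptr A :=
  le_self_add.trans (ptr_conj_add_le hA (W := (0 : E →L[ℂ] E)) (by simpa using hT))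

theorem qEntropy_conj_le {A : E →L[ℂ] E} (hA : A.IsPositive) (ht : ptr A ≠ ∞) {T : E →L[ℂ] F}
    (hT : ∀ x, ‖T x‖ ^ 2 ≤ ‖x‖ ^ 2) : qEntropy (conj T A) ≤ qEntropy A :=
  le_self_add.trans (qEntropy_conj_add_le hA ht (W := (0 : E →L[ℂ] E)) (by simpa using hT))

end Decomposition

section Analysis

variable {E F : Type*}
variable [NormedAddCommGroup E] [InnerProductSpace ℂ E] [CompleteSpace E]
variable [NormedAddCommGroup F] [InnerProductSpace ℂ F] [CompleteSpace F]
variable {ι κ : Type*} [Fintype ι]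

/-- The analysis operator `x ↦ (⟪fᵢ, x⟫)ᵢ` of a finite family. -/
def anal (f : ι → E) : E →L[ℂ] EuclideanSpace ℂ ι :=
  (EuclideanSpace.equiv ι ℂ).symm.toContinuousLinearMap ∘L
    ContinuousLinearMap.pi fun i => innerSL ℂ (f i)

theorem anal_apply (f : ι → E) (x : E) (i : ι) : anal f x i = inner ℂ (f i) x := rfl

theorem norm_anal_sq (f : ι → E) (x : E) :
    ‖anal f x‖ ^ 2 = ∑ i, ‖(inner ℂ (f i) x : ℂ)‖ ^ 2 := by
  simp only [EuclideanSpace.norm_sq_eq, anal_apply]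

theorem adjoint_anal (f : ι → E) (c : EuclideanSpace ℂ ι) :
    ContinuousLinearMap.adjoint (anal f) c = ∑ i, c i • f i := by
  refine ext_inner_left ℂ fun x => ?_
  rw [ContinuousLinearMap.adjoint_inner_right, inner_sum, PiLp.inner_apply]
  refine Finset.sum_congr rfl fun i _ => ?_
  rw [anal_apply, inner_smul_right, ← inner_conj_symm x (f i)]
  simp

theorem norm_anal_sq_le {f : ι → E} (hf : Orthonormal ℂ f) (x : E) :
    ‖anal f x‖ ^ 2 ≤ ‖x‖ ^ 2 := by
  rw [norm_anal_sq]
  exact hf.sum_inner_products_le x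

theorem norm_adjoint_anal_sq {f : ι → E} (hf : Orthonormal ℂ f) (c : EuclideanSpace ℂ ι) :
    ‖ContinuousLinearMap.adjoint (anal f) c‖ ^ 2 = ∑ i, ‖c i‖ ^ 2 := by
  have h : (inner ℂ (∑ i, c i • f i) (∑ i, c i • f i) : ℂ) = ((∑ i, ‖c i‖ ^ 2 : ℝ) : ℂ) := by
    rw [hf.inner_sum, Complex.ofReal_sum]
    refine Finset.sum_congr rfl fun i _ => ?_
    rw [Complex.conj_mul']
    push_cast
    rfl
  rw [inner_self_eq_norm_sq_to_K] at h
  rw [adjoint_anal]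
  exact Complex.ofReal_injective (by norm_cast at h)

theorem qf_adjoint_anal {A : E →L[ℂ] E} {f : ι → E} (hf : Orthonormal ℂ f)
    (hA : ∀ i, A (f i) = (qf A (f i) : ℂ) • f i) (c : EuclideanSpace ℂ ι) :
    qf A (ContinuousLinearMap.adjoint (anal f) c) = ∑ i, ‖c i‖ ^ 2 * qf A (f i) := by
  have : (inner ℂ (∑ i, c i • f i) (A (∑ i, c i • f i)) : ℂ)
      = ((∑ i, ‖c i‖ ^ 2 * qf A (f i) : ℝ) : ℂ) := by
    simp only [map_sum, map_smul]
    have h1 : ∑ i, c i • A (f i) = ∑ i, (c i * qf A (f i)) • f i :=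
      Finset.sum_congr rfl fun i _ => by
        conv_lhs => rw [hA i, smul_smul]
    rw [h1, hf.inner_sum, Complex.ofReal_sum]
    refine Finset.sum_congr rfl fun i _ => ?_
    rw [← mul_assoc, Complex.conj_mul']
    push_cast
    rfl
  rw [adjoint_anal, qf, this, Complex.ofReal_re]

/-- The classical entropy of some eigenvalues is the entropy of the compression to the
eigenvectors. -/
theorem Hc_eigenvalues_le {A : E →L[ℂ] E} (hA : A.IsPositive) {f : ι → E} (hf : Orthonormal ℂ f)
    (hAf : ∀ i, A (f i) = (qf A (f i) : ℂ) • f i) {t : Set (EuclideanSpace ℂ ι)} (ht : IsONB t) :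
    Hc (fun i => ENNReal.ofReal (qf A (f i)))
      ≤ Hc (fun v : t => ENNReal.ofReal (qf A (ContinuousLinearMap.adjoint (anal f) v))) := by
  have hin : ∀ (i : ι) (v : EuclideanSpace ℂ ι),
      ‖(inner ℂ v (EuclideanSpace.single i (1 : ℂ)) : ℂ)‖ₑ = ‖v i‖ₑ := by
    intro i v
    rw [EuclideanSpace.inner_single_right, one_mul, ← ofReal_norm, ← ofReal_norm, RCLike.norm_conj]
  have h1 : ∀ i : ι, ∑' v : t, ‖(v : EuclideanSpace ℂ ι) i‖ₑ ^ 2 = 1 := by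
    intro i
    have h := ht.isFrame (EuclideanSpace.single i (1 : ℂ))
    simp only [hin] at h
    rw [h, enorm_sq_eq_ofReal]
    simp
  have h2 : ∀ v : t, ∑' i, ‖(v : EuclideanSpace ℂ ι) i‖ₑ ^ 2 = 1 := by
    intro v
    have h := EuclideanSpace.norm_sq_eq (v : EuclideanSpace ℂ ι)
    rw [ht.1.1 v] at h
    rw [tsum_fintype]
    simp only [enorm_sq_eq_ofReal]
    rw [← ENNReal.ofReal_sum_of_nonneg (fun _ _ => by positivity), ← h]
    simp
  have hd : ∀ v : t, ENNReal.ofReal (qf A (ContinuousLinearMap.adjoint (anal f) v))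
      = ∑' i, ‖(v : EuclideanSpace ℂ ι) i‖ₑ ^ 2 * ENNReal.ofReal (qf A (f i)) := by
    intro v
    rw [qf_adjoint_anal hf hAf, tsum_fintype, ENNReal.ofReal_sum_of_nonneg
      (fun i _ => mul_nonneg (by positivity) (qf_nonneg hA _))]
    refine Finset.sum_congr rfl fun i _ => ?_
    rw [enorm_sq_eq_ofReal, ENNReal.ofReal_mul (by positivity)]
  refine Hc_le_of_mixing (fun i v => ‖(v : EuclideanSpace ℂ ι) i‖ₑ ^ 2) (fun i _ => h1 i)
    (fun v => (h2 v).le) hd ?_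
  simp only [hd]
  rw [ENNReal.tsum_comm]
  simp only [ENNReal.tsum_mul_right, h1, one_mul]
  rw [tsum_fintype]
  exact (ENNReal.sum_lt_top.2 fun i _ => ENNReal.ofReal_lt_top).ne

theorem le_qf_of_norm_sub_le {A B : E →L[ℂ] E} {δ : ℝ} (h : ‖B - A‖ ≤ δ) (x : E) :
    qf A x - δ * ‖x‖ ^ 2 ≤ qf B x := by
  have h1 : qf A x - qf B x = (inner ℂ x ((A - B) x) : ℂ).re := by
    simp [qf, sub_apply]
  have h2 : (inner ℂ x ((A - B) x) : ℂ).re ≤ δ * ‖x‖ ^ 2 :=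
    calc (inner ℂ x ((A - B) x) : ℂ).re ≤ ‖(inner ℂ x ((A - B) x) : ℂ)‖ := Complex.re_le_norm _
      _ ≤ ‖x‖ * ‖(A - B) x‖ := norm_inner_le_norm _ _
      _ ≤ ‖x‖ * (‖A - B‖ * ‖x‖) := by gcongr; exact ContinuousLinearMap.le_opNorm _ _
      _ = ‖B - A‖ * ‖x‖ ^ 2 := by rw [norm_sub_rev]; ring
      _ ≤ δ * ‖x‖ ^ 2 := by gcongr
  linarith

/-- Lower bound for the entropy of a finite compression near `A`. -/
theorem mul_Hc_le_qEntropy_anal {A B : E →L[ℂ] E} (hA : A.IsPositive) (hB : B.IsPositive)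
    (hBt : ptr B ≠ ∞) {f : ι → E} (hf : Orthonormal ℂ f)
    (hAf : ∀ i, A (f i) = (qf A (f i) : ℂ) • f i) {m θ : ℝ}
    (hm : ∀ i, m ≤ qf A (f i)) (hθ0 : 0 ≤ θ) (hθ1 : θ ≤ 1) (hAB : ‖B - A‖ ≤ m * θ) :
    ENNReal.ofReal (1 - θ) * Hc (fun i => ENNReal.ofReal (qf A (f i)))
      ≤ qEntropy (conj (anal f) B) := by
  have htr : ptr (conj (anal f) B) ≠ ∞ :=
    ne_top_of_le_ne_top hBt (ptr_conj_le hB (norm_anal_sq_le hf))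
  refine le_qEntropy (isPositive_conj hB _) htr fun t ht => ?_
  calc _ ≤ ENNReal.ofReal (1 - θ) *
        Hc (fun v : t => ENNReal.ofReal (qf A (ContinuousLinearMap.adjoint (anal f) v))) := by
        gcongr
        exact Hc_eigenvalues_le hA hf hAf ht
    _ = Hc (fun v : t => ENNReal.ofReal (1 - θ) *
        ENNReal.ofReal (qf A (ContinuousLinearMap.adjoint (anal f) v))) :=
        (Hc_mul_left _ ENNReal.ofReal_ne_top).symm
    _ ≤ _ := by
      refine Hc_mono (fun v => ?_) (by rwa [ht.isFrame.tsum_qf (isPositive_conj hB _)])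
      rw [← ENNReal.ofReal_mul (by linarith), qf_conj]
      refine ENNReal.ofReal_le_ofReal ?_
      have h1 := le_qf_of_norm_sub_le hAB (ContinuousLinearMap.adjoint (anal f) v)
      have h2 : m * ‖ContinuousLinearMap.adjoint (anal f) v‖ ^ 2
          ≤ qf A (ContinuousLinearMap.adjoint (anal f) v) := by
        rw [norm_adjoint_anal_sq hf, qf_adjoint_anal hf hAf, Finset.mul_sum]
        refine Finset.sum_le_sum fun i _ => ?_
        rw [mul_comm]
        gcongr
        exact hm i
      nlinarith [mul_le_mul_of_nonneg_left h2 hθ0]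

/-- Lower semicontinuity of the quantum entropy, witnessed by a finite compression. -/
theorem exists_compression {A : E →L[ℂ] E} (hA : A.IsPositive) (ht : ptr A ≠ ∞)
    (hH : qEntropy A ≠ ∞) {s : Set E} (hs : IsONB s) (hse : ∀ v ∈ s, A v = (qf A v : ℂ) • v)
    {ε : ℝ} (hε : 0 < ε) :
    ∃ Φ : Finset s, ptr A ≤ ∑ v ∈ Φ, ENNReal.ofReal (qf A v) + ENNReal.ofReal ε ∧
      ∃ δ > 0, ∀ B : E →L[ℂ] E, B.IsPositive → ptr B ≠ ∞ → ‖B - A‖ ≤ δ →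
        qEntropy A ≤ qEntropy (conj (anal fun v : Φ => ((v : s) : E)) B) + ENNReal.ofReal ε := by
  have hlam : ∑' v : s, ENNReal.ofReal (qf A v) = ptr A := hs.isFrame.tsum_qf hA
  have approx : ∀ (x : s → ℝ≥0∞) (c : ℝ≥0∞), c ≠ ∞ → c ≤ ∑' v, x v → ∀ η : ℝ, 0 < η →
      ∃ Φ : Finset s, c ≤ ∑ v ∈ Φ, x v + ENNReal.ofReal η := by
    intro x c hc hcx η hη
    by_cases h0 : c = 0
    · exact ⟨∅, by simp [h0]⟩
    · have hlt : c - ENNReal.ofReal η < ⨆ Φ : Finset s, ∑ v ∈ Φ, x v := by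
        rw [← ENNReal.tsum_eq_iSup_sum]
        exact (ENNReal.sub_lt_self hc h0 (by simpa using hη)).trans_le hcx
      obtain ⟨Φ, hΦ⟩ := lt_iSup_iff.1 hlt
      exact ⟨Φ, tsub_le_iff_right.1 hΦ.le⟩
  obtain ⟨Φ₁, h₁⟩ := approx (fun v => ENNReal.ofReal (qf A v)) (ptr A) ht hlam.ge (ε / 3)
    (by positivity)
  obtain ⟨Φ₂, h₂⟩ := approx (fun v => phi (ptr A) (ENNReal.ofReal (qf A v))) (qEntropy A) hH
    (by simpa only [Hc, hlam] using qEntropy_le hA ht hs) (ε / 3) (by positivity)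
  let Φ : Finset s := (Φ₁ ∪ Φ₂).filter fun v => qf A v ≠ 0
  have hmono : ∀ (x : s → ℝ≥0∞) (Ψ : Finset s), Ψ ⊆ Φ₁ ∪ Φ₂ → (∀ v : s, qf A v = 0 → x v = 0) →
      ∑ v ∈ Ψ, x v ≤ ∑ v ∈ Φ, x v := by
    intro x Ψ hΨ hx
    have hΦ : ∑ v ∈ Φ, x v = ∑ v ∈ Φ₁ ∪ Φ₂, x v :=
      Finset.sum_filter_of_ne fun v _ hv hq => hv (hx v hq)
    rw [hΦ]
    exact Finset.sum_le_sum_of_subset hΨ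
  have h₁' : ptr A ≤ ∑ v ∈ Φ, ENNReal.ofReal (qf A v) + ENNReal.ofReal (ε / 3) :=
    h₁.trans (by gcongr ?_ + _; exact hmono _ _ Finset.subset_union_left (fun v hv => by simp [hv]))
  have h₂' : qEntropy A ≤ ∑ v ∈ Φ, phi (ptr A) (ENNReal.ofReal (qf A v))
      + ENNReal.ofReal (ε / 3) :=
    h₂.trans (by gcongr ?_ + _; exact hmono _ _ Finset.subset_union_right (fun v hv => by simp [hv]))
  let x : Φ → ℝ≥0∞ := fun v => ENNReal.ofReal (qf A (v : s))
  have hx : ∑' v, x v = ∑ v ∈ Φ, ENNReal.ofReal (qf A v) := by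
    rw [tsum_fintype]
    exact Finset.sum_coe_sort Φ (fun v => ENNReal.ofReal (qf A v))
  have hxle : ∑' v, x v ≤ ptr A := by
    rw [hx, ← hlam]
    exact ENNReal.sum_le_tsum Φ
  have hHx : qEntropy A ≤ Hc x + ENNReal.ofReal (ε / 3) + ENNReal.ofReal (ε / 3) := by
    refine h₂'.trans ?_
    gcongr ?_ + _
    have h3 := tsum_phi_le_Hc_add ht hxle
    have h4 : phi (ptr A) (∑' v, x v) ≤ ENNReal.ofReal (ε / 3) :=
      (phi_le_of_add_eq ht (add_tsub_cancel_of_le hxle)).trans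
        (tsub_le_iff_left.2 (by rwa [hx]))
    have h5 : ∑' v, phi (ptr A) (x v) = ∑ v ∈ Φ, phi (ptr A) (ENNReal.ofReal (qf A v)) := by
      rw [tsum_fintype]
      exact Finset.sum_coe_sort Φ (fun v => phi (ptr A) (ENNReal.ofReal (qf A v)))
    rw [← h5]
    exact h3.trans (by gcongr)
  have hxtop : Hc x ≠ ∞ := by
    rw [Hc, tsum_fintype]
    exact (ENNReal.sum_lt_top.2 fun v _ => (phi_ne_top _ _).lt_top).ne
  obtain ⟨m, hm0, hm⟩ : ∃ m : ℝ, 0 < m ∧ ∀ v : Φ, m ≤ qf A (v : s) := by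
    have hpos : ∀ v : Φ, 0 < qf A (v : s) := fun v =>
      lt_of_le_of_ne (qf_nonneg hA _) (Finset.mem_filter.1 v.2).2.symm
    rcases isEmpty_or_nonempty Φ with hΦ | hΦ
    · exact ⟨1, one_pos, fun v => hΦ.elim v⟩
    · obtain ⟨v, hv⟩ := Finite.exists_min (fun v : Φ => qf A (v : s))
      exact ⟨_, hpos v, hv⟩
  let θ : ℝ := min 1 (ε / 3 / ((Hc x).toReal + 1))
  have hC : 0 ≤ (Hc x).toReal := ENNReal.toReal_nonneg
  have hθ0 : 0 < θ := lt_min one_pos (by positivity)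
  refine ⟨Φ, h₁'.trans ?_, m * θ, by positivity, fun B hB hBt hAB => ?_⟩
  · gcongr
    linarith
  have horth : Orthonormal ℂ (fun v : Φ => ((v : s) : E)) :=
    hs.1.comp _ Subtype.val_injective
  have hlow := mul_Hc_le_qEntropy_anal hA hB hBt horth (fun v => hse _ (v : s).2) hm hθ0.le
    (min_le_left _ _) hAB
  have hθC : θ * (Hc x).toReal ≤ ε / 3 := by
    have h6 : θ ≤ ε / 3 / ((Hc x).toReal + 1) := min_le_right _ _
    rw [le_div_iff₀ (by positivity)] at h6
    nlinarith
  have hfin : Hc x ≤ ENNReal.ofReal (1 - θ) * Hc x + ENNReal.ofReal (ε / 3) := by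
    have hθ1 : θ ≤ 1 := min_le_left _ _
    have h1θ : 0 ≤ 1 - θ := by linarith
    conv_lhs => rw [← ENNReal.ofReal_toReal hxtop]
    conv_rhs => rw [← ENNReal.ofReal_toReal hxtop]
    rw [← ENNReal.ofReal_mul h1θ, ← ENNReal.ofReal_add (by positivity) (by positivity)]
    exact ENNReal.ofReal_le_ofReal (by nlinarith)
  calc qEntropy A ≤ Hc x + ENNReal.ofReal (ε / 3) + ENNReal.ofReal (ε / 3) := hHx
    _ ≤ qEntropy (conj (anal fun v : Φ => ((v : s) : E)) B) + ENNReal.ofReal (ε / 3)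
        + ENNReal.ofReal (ε / 3) + ENNReal.ofReal (ε / 3) := by
      gcongr
      exact hfin.trans (by gcongr)
    _ = _ := by
      rw [add_assoc, add_assoc, ← ENNReal.ofReal_add (by positivity) (by positivity),
        ← ENNReal.ofReal_add (by positivity) (by positivity)]
      congr 2
      ring

end Analysis

section UpperBound

variable {E F G : Type*}
variable [NormedAddCommGroup E] [InnerProductSpace ℂ E] [CompleteSpace E]
variable [NormedAddCommGroup F] [InnerProductSpace ℂ F] [CompleteSpace F]
variable [NormedAddCommGroup G] [InnerProductSpace ℂ G] [CompleteSpace G]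
variable {κ : Type*}

theorem qf_ofReal_smul (A : E →L[ℂ] E) (r : ℝ) (x : E) :
    qf A ((r : ℂ) • x) = r ^ 2 * qf A x := by
  simp only [qf, map_smul, inner_smul_left, inner_smul_right, Complex.conj_ofReal]
  rw [← mul_assoc, ← Complex.ofReal_mul, Complex.re_ofReal_mul, sq]

theorem enorm_inner_sqrt_smul_sq {q : ℝ} (hq : 0 ≤ q) (e x : E) :
    ‖(inner ℂ ((√q : ℂ) • e) x : ℂ)‖ₑ ^ 2 = ENNReal.ofReal q * ‖(inner ℂ e x : ℂ)‖ₑ ^ 2 := by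
  rw [inner_smul_left, enorm_mul, mul_pow]
  congr 1
  rw [enorm_sq_eq_ofReal, RCLike.norm_conj, Complex.norm_real,
    Real.norm_of_nonneg (Real.sqrt_nonneg q), Real.sq_sqrt hq]

/-- The resolution of identity `T*T + W*W + ∑ₖ qₖ |eₖ⟩⟨eₖ| = 1`. -/
def IsResolution (T : E →L[ℂ] G) (W : E →L[ℂ] F) (q : κ → ℝ) (e : κ → E) : Prop :=
  ∀ x, ‖T x‖ₑ ^ 2 + (‖W x‖ₑ ^ 2 + ∑' k, ENNReal.ofReal (q k) * ‖(inner ℂ (e k) x : ℂ)‖ₑ ^ 2)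
    = ‖x‖ₑ ^ 2

variable {T : E →L[ℂ] G} {W : E →L[ℂ] F} {q : κ → ℝ} {e : κ → E}

theorem IsResolution.isFrame (h : IsResolution T W q e) (hq : ∀ k, 0 ≤ q k) {g : Set G}
    (hg : IsONB g) {v : Set F} (hv : IsONB v) :
    IsFrame (Sum.elim (fun i : g => ContinuousLinearMap.adjoint T i)
      (Sum.elim (fun i : v => ContinuousLinearMap.adjoint W i) fun k => (√(q k) : ℂ) • e k)) := by
  intro x
  rw [ENNReal.summable.tsum_sum ENNReal.summable, ENNReal.summable.tsum_sum ENNReal.summable]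
  simp only [Sum.elim_inl, Sum.elim_inr, ContinuousLinearMap.adjoint_inner_left,
    hg.isFrame (T x), hv.isFrame (W x), enorm_inner_sqrt_smul_sq (hq _)]
  exact h x

theorem ofReal_qf_sqrt_smul {B : E →L[ℂ] E} {r : ℝ} (hr : 0 ≤ r) (x : E) :
    ENNReal.ofReal (qf B ((√r : ℂ) • x)) = ENNReal.ofReal r * ENNReal.ofReal (qf B x) := by
  rw [qf_ofReal_smul, Real.sq_sqrt hr, ENNReal.ofReal_mul hr]

theorem IsResolution.ptr_eq (h : IsResolution T W q e) (hq : ∀ k, 0 ≤ q k) {B : E →L[ℂ] E}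
    (hB : B.IsPositive) :
    ptr (conj T B) + (ptr (conj W B) + ∑' k, ENNReal.ofReal (q k) * ENNReal.ofReal (qf B (e k)))
      = ptr B := by
  rw [← (h.isFrame hq isONB_stdONB isONB_stdONB).tsum_qf hB,
    ENNReal.summable.tsum_sum ENNReal.summable, ENNReal.summable.tsum_sum ENNReal.summable]
  simp only [Sum.elim_inl, Sum.elim_inr, ofReal_qf_sqrt_smul (hq _), ← qf_conj]
  rfl

theorem IsResolution.qEntropy_le (h : IsResolution T W q e) (hq0 : ∀ k, 0 < q k)
    (hq1 : ∀ k, q k ≤ 1) {l : ℝ} (hl : 0 ≤ l) {B : E →L[ℂ] E} (hB : B.IsPositive)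
    (hBt : ptr B ≠ ∞) {g : Set G} (hg : IsONB g) {K : ℝ} (hK : 0 ≤ K) {σ : ℝ≥0∞}
    (hσ : ptr (conj W B) + ∑' k, ENNReal.ofReal (q k) * ENNReal.ofReal (qf B (e k)) = σ) :
    qEntropy B ≤ qEntropy (conj W B) + (Hc (fun i : g => ENNReal.ofReal (qf (conj T B) i))
      + (ENNReal.ofReal l + ∑' k, ENNReal.ofReal (Real.exp (-(l / q k))))
          * ∑' k, ENNReal.ofReal (qf B (e k))
      + (3 + ENNReal.ofReal K) * σ + ptr B * ENNReal.ofReal (Real.exp (-K))) := by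
  have hq : ∀ k, 0 ≤ q k := fun k => (hq0 k).le
  have htr := h.ptr_eq hq hB
  rw [hσ] at htr
  have hσt : σ ≠ ∞ := ne_top_of_le_ne_top hBt (htr ▸ le_add_self)
  have hT : ptr (conj T B) ≠ ∞ := ne_top_of_le_ne_top hBt (htr ▸ le_self_add)
  have hW : ptr (conj W B) ≠ ∞ := ne_top_of_le_ne_top hσt (hσ ▸ le_self_add)
  let c : κ → ℝ≥0∞ := fun k => ENNReal.ofReal (q k) * ENNReal.ofReal (qf B (e k))
  have hct : ∑' k, c k ≠ ∞ := ne_top_of_le_ne_top hσt (hσ ▸ le_add_self)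
  have hcle : ∑' k, c k ≤ ∑' k, ENNReal.ofReal (qf B (e k)) :=
    ENNReal.tsum_le_tsum fun k => by
      calc c k ≤ 1 * ENNReal.ofReal (qf B (e k)) := by
            refine mul_le_mul_left ?_ _
            rw [← ENNReal.ofReal_one]
            exact ENNReal.ofReal_le_ofReal (hq1 k)
        _ = _ := one_mul _
  have hHc : Hc c ≤ (ENNReal.ofReal l + ∑' k, ENNReal.ofReal (Real.exp (-(l / q k))))
      * ∑' k, ENNReal.ofReal (qf B (e k)) := by
    refine (Hc_le_gibbs hct fun k => div_nonneg hl (hq k)).trans ?_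
    have h1 : ∑' k, c k * ENNReal.ofReal (l / q k)
        = ENNReal.ofReal l * ∑' k, ENNReal.ofReal (qf B (e k)) := by
      rw [← ENNReal.tsum_mul_left]
      refine tsum_congr fun k => ?_
      rw [mul_right_comm, ← ENNReal.ofReal_mul (hq k), mul_div_cancel₀ _ (hq0 k).ne']
    rw [h1, add_mul, mul_comm (∑' k, c k)]
    gcongr
  rw [← tsub_le_iff_right]
  refine le_qEntropy (isPositive_conj hB W) hW fun v hv => ?_
  rw [tsub_le_iff_right]
  refine (qEntropy_le_Hc_frame hB hBt (h.isFrame hq hg hv)).trans ?_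
  set a : g → ℝ≥0∞ := fun i => ENNReal.ofReal (qf (conj T B) i)
  set b : v → ℝ≥0∞ := fun i => ENNReal.ofReal (qf (conj W B) i)
  have hsa : ∑' i, a i = ptr (conj T B) := hg.isFrame.tsum_qf (isPositive_conj hB T)
  have hsb : ∑' i, b i = ptr (conj W B) := hv.isFrame.tsum_qf (isPositive_conj hB W)
  have heq : (fun k => ENNReal.ofReal (qf B (Sum.elim (fun i : g => ContinuousLinearMap.adjoint T i)
      (Sum.elim (fun i : v => ContinuousLinearMap.adjoint W i) fun k => (√(q k) : ℂ) • e k) k)))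
      = Sum.elim a (Sum.elim b c) := by
    funext k
    rcases k with i | i | k
    · simp only [Sum.elim_inl, a, qf_conj]
    · simp only [Sum.elim_inl, Sum.elim_inr, b, qf_conj]
    · simp only [Sum.elim_inr, c, ofReal_qf_sqrt_smul (hq _)]
  rw [heq]
  have hsbc : ∑' i, Sum.elim b c i = σ := by
    rw [ENNReal.summable.tsum_sum ENNReal.summable]
    simp only [Sum.elim_inl, Sum.elim_inr]
    rw [hsb, hσ]
  have h1 := Hc_sum_elim_le (x := a) (y := Sum.elim b c) (by rwa [hsa]) (by rwa [hsbc]) hK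
  have h2 := Hc_sum_elim_le (x := b) (y := c) (by rwa [hsb]) hct le_rfl
  have h3 : Hc (Sum.elim b c) ≤ Hc b + Hc c + (σ + σ) := by
    refine h2.trans ?_
    rw [hsb, hσ, add_assoc]
    simp only [ENNReal.ofReal_zero, add_zero, one_mul, neg_zero, Real.exp_zero,
      ENNReal.ofReal_one, mul_one]
    gcongr
    rw [← hσ]
    exact le_add_self
  rw [hsa, hsbc, htr] at h1
  calc _ ≤ Hc a + (Hc b + Hc c + (σ + σ)) + (1 + ENNReal.ofReal K) * σ
        + ptr B * ENNReal.ofReal (Real.exp (-K)) := h1.trans (by gcongr)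
    _ = Hc b + (Hc a + Hc c + (3 + ENNReal.ofReal K) * σ
        + ptr B * ENNReal.ofReal (Real.exp (-K))) := by ring
    _ ≤ _ := by gcongr

end UpperBound

section TraceNorm

variable {E F : Type*}
variable [NormedAddCommGroup E] [InnerProductSpace ℂ E] [CompleteSpace E]
variable [NormedAddCommGroup F] [InnerProductSpace ℂ F] [CompleteSpace F]
variable {ι : Type*}

theorem sum_le_traceNorm (C : E →L[ℂ] E) {n : ℕ} {e f : Fin n → E} (he : Orthonormal ℂ e)
    (hf : Orthonormal ℂ f) :
    ∑ i, ENNReal.ofReal ‖(inner ℂ (e i) (C (f i)) : ℂ)‖ ≤ traceNorm C :=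
  le_iSup_of_le n <| le_iSup_of_le e <| le_iSup_of_le f <| le_iSup_of_le he <|
    le_iSup_of_le hf le_rfl

theorem tsum_le_traceNorm (C : E →L[ℂ] E) {e : ι → E} (he : Orthonormal ℂ e) :
    ∑' i, ENNReal.ofReal ‖(inner ℂ (e i) (C (e i)) : ℂ)‖ ≤ traceNorm C := by
  rw [ENNReal.tsum_eq_iSup_sum]
  refine iSup_le fun Φ => ?_
  have h : Orthonormal ℂ (fun k : Fin Φ.card => e (Φ.equivFin.symm k)) :=
    he.comp _ (Subtype.val_injective.comp Φ.equivFin.symm.injective)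
  refine le_trans (le_of_eq ?_) (sum_le_traceNorm C h h)
  rw [← Finset.sum_coe_sort Φ]
  exact (Equiv.sum_comp Φ.equivFin.symm
    (fun i : Φ => ENNReal.ofReal ‖(inner ℂ (e i) (C (e i)) : ℂ)‖)).symm

theorem norm_le_of_traceNorm_le {C : E →L[ℂ] E} {δ : ℝ} (hδ : 0 ≤ δ)
    (h : traceNorm C ≤ ENNReal.ofReal δ) : ‖C‖ ≤ δ := by
  refine ContinuousLinearMap.opNorm_le_bound _ hδ fun x => ?_
  by_cases hx : x = 0
  · simp [hx]
  by_cases hy : C x = 0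
  · rw [hy, norm_zero]
    positivity
  have hu : ∀ z : E, z ≠ 0 → Orthonormal ℂ (fun _ : Fin 1 => ((‖z‖⁻¹ : ℝ) : ℂ) • z) := by
    intro z hz
    refine ⟨fun _ => ?_, fun i j hij => (hij (Subsingleton.elim i j)).elim⟩
    rw [norm_smul, Complex.norm_real, norm_inv, norm_norm, inv_mul_cancel₀ (norm_ne_zero_iff.2 hz)]
  have h1 := (sum_le_traceNorm C (hu _ hy) (hu _ hx)).trans h
  have hx' : 0 < ‖x‖ := norm_pos_iff.2 hx
  have hy' : 0 < ‖C x‖ := norm_pos_iff.2 hy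
  have h2 : ‖(inner ℂ (((‖C x‖⁻¹ : ℝ) : ℂ) • C x) (C (((‖x‖⁻¹ : ℝ) : ℂ) • x)) : ℂ)‖
      = ‖C x‖ / ‖x‖ := by
    rw [map_smul, inner_smul_left, inner_smul_right, inner_self_eq_norm_sq_to_K]
    simp only [norm_mul, RCLike.norm_conj, Complex.norm_real, norm_inv, norm_norm, norm_pow,
      RCLike.norm_ofReal, abs_norm]
    field_simp
  rw [Finset.sum_const, Finset.card_univ, Fintype.card_fin, one_smul, h2,
    ENNReal.ofReal_le_ofReal_iff hδ, div_le_iff₀ hx'] at h1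
  exact h1

theorem tsum_qf_le_add (A B : E →L[ℂ] E) {e : ι → E} (he : Orthonormal ℂ e) :
    ∑' i, ENNReal.ofReal (qf B (e i))
      ≤ ∑' i, ENNReal.ofReal (qf A (e i)) + traceNorm (B - A) := by
  refine le_trans ?_ (add_le_add_right (tsum_le_traceNorm (B - A) he) _)
  rw [← ENNReal.tsum_add]
  refine ENNReal.tsum_le_tsum fun i => ?_
  refine le_trans (ENNReal.ofReal_le_ofReal ?_) ENNReal.ofReal_add_le
  have h1 : qf B (e i) - qf A (e i) = (inner ℂ (e i) ((B - A) (e i)) : ℂ).re := by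
    simp [qf, sub_apply]
  have h2 := Complex.re_le_norm (inner ℂ (e i) ((B - A) (e i)))
  linarith

theorem ptr_le_add (A B : E →L[ℂ] E) : ptr B ≤ ptr A + traceNorm (B - A) :=
  tsum_qf_le_add A B isONB_stdONB.1

theorem ptr_ne_top {A : E →L[ℂ] E} (hA : A ∈ posTC E) : ptr A ≠ ∞ := by
  have h := ptr_le_add 0 A
  have h0 : ptr (0 : E →L[ℂ] E) = 0 := by simp [ptr, qf]
  rw [h0, zero_add, sub_zero] at h
  exact ne_top_of_le_ne_top hA.2 h

end TraceNorm

section Defect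

variable {E F : Type*}
variable [NormedAddCommGroup E] [InnerProductSpace ℂ E] [CompleteSpace E]
variable [NormedAddCommGroup F] [InnerProductSpace ℂ F] [CompleteSpace F]

/-- A self-adjoint operator vanishing on the complement of orthonormal eigenvectors is diagonal. -/
theorem hasSum_eigen {ι : Type*} {S : E →L[ℂ] E} (hS : ContinuousLinearMap.adjoint S = S)
    {e : ι → E} (he : Orthonormal ℂ e) {q : ι → ℝ} (hSe : ∀ i, S (e i) = (q i : ℂ) • e i)
    (hS0 : ∀ x, (∀ i, (inner ℂ (e i) x : ℂ) = 0) → S x = 0) (x : E) :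
    HasSum (fun i => q i * ‖(inner ℂ (e i) x : ℂ)‖ ^ 2) (qf S x) := by
  obtain ⟨w, b, hw, hb⟩ := he.toSubtypeRange.exists_hilbertBasis_extension
  have horth := b.orthonormal
  rw [hb] at horth
  have h := b.hasSum_inner_mul_inner x (S x)
  rw [hb] at h
  let j : ι → w := fun i => ⟨e i, hw (Set.mem_range_self i)⟩
  have hj : Function.Injective j := fun i i' hii =>
    he.linearIndependent.injective (congrArg Subtype.val hii)
  have hz : ∀ v ∉ Set.range j,
      (inner ℂ x (v : E) : ℂ) * inner ℂ (v : E) (S x) = 0 := by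
    intro v hv
    have : S v = 0 := hS0 v fun i => horth.2 (i := j i) (j := v) fun hi => hv ⟨i, hi⟩
    rw [← ContinuousLinearMap.adjoint_inner_left, hS, this, inner_zero_left, mul_zero]
  have h2 := Complex.hasSum_re ((hj.hasSum_iff hz).2 h)
  change HasSum _ (qf S x) at h2
  convert h2 using 1
  funext i
  have : (inner ℂ x (e i) : ℂ) * inner ℂ (e i) (S x)
      = ((q i * ‖(inner ℂ (e i) x : ℂ)‖ ^ 2 : ℝ) : ℂ) := by
    rw [← ContinuousLinearMap.adjoint_inner_left, hS, hSe, inner_smul_left, Complex.conj_ofReal,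
      ← inner_conj_symm x (e i), mul_left_comm, Complex.conj_mul']
    push_cast
    rfl
  simp only [Function.comp_apply, j, this, Complex.ofReal_re]

theorem exists_defect {V : E →L[ℂ] F}
    (hlam : LamStarSqrtFin ((1 : E →L[ℂ] E) - ContinuousLinearMap.adjoint V ∘L V)) :
    ∃ (I : Set ℕ) (q : I → ℝ) (e : I → E) (l : ℝ), 0 < l ∧ Orthonormal ℂ e ∧
      (∀ i, 0 < q i) ∧ (∀ i, q i ≤ 1) ∧ ∑' i, ENNReal.ofReal (Real.exp (-(l / q i))) ≠ ∞ ∧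
      ∀ x, ‖V x‖ₑ ^ 2 + ∑' i, ENNReal.ofReal (q i) * ‖(inner ℂ (e i) x : ℂ)‖ₑ ^ 2
        = ‖x‖ₑ ^ 2 := by
  obtain ⟨ν, hν, ⟨e, horth, hnorm, hSe, hS0⟩, l, hl, hZ⟩ := hlam
  set S : E →L[ℂ] E := 1 - ContinuousLinearMap.adjoint V ∘L V with hSdef
  have hS : ContinuousLinearMap.adjoint S = S := by
    rw [hSdef, map_sub, ContinuousLinearMap.adjoint_comp, ContinuousLinearMap.adjoint_adjoint]
    congr 1
    exact ContinuousLinearMap.adjoint_id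
  have hqS : ∀ x, qf S x = ‖x‖ ^ 2 - ‖V x‖ ^ 2 := by
    intro x
    simp only [qf, hSdef, sub_apply, inner_sub_right, Complex.sub_re,
      ContinuousLinearMap.comp_apply, ContinuousLinearMap.adjoint_inner_right,
      one_apply_eq_self]
    rw [inner_self_eq_norm_sq_to_K, inner_self_eq_norm_sq_to_K]
    norm_cast
  let I : Set ℕ := {i | ν i ≠ 0}
  have hpos : ∀ i : I, 0 < ν i ^ 2 := fun i => pow_pos (lt_of_le_of_ne (hν i) i.2.symm) 2
  have he : Orthonormal ℂ (fun i : I => e i) :=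
    ⟨fun i => (hnorm i).1 (hpos i).ne', fun i j hij => horth i j fun h => hij (Subtype.ext h)⟩
  have hid : ∀ x, ‖V x‖ₑ ^ 2
      + ∑' i : I, ENNReal.ofReal (ν i ^ 2) * ‖(inner ℂ (e i) x : ℂ)‖ₑ ^ 2 = ‖x‖ₑ ^ 2 := by
    intro x
    have h := hasSum_eigen hS he (q := fun i : I => ν i ^ 2) (fun i => hSe i)
      (fun x hx => hS0 x fun i => by
        by_cases hi : ν i = 0
        · rw [(hnorm i).2 (by simp [hi]), inner_zero_left]
        · exact hx ⟨i, hi⟩) x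
    have h0 : 0 ≤ qf S x := h.nonneg fun i => by positivity
    have h1 : ∑' i : I, ENNReal.ofReal (ν i ^ 2) * ‖(inner ℂ (e i) x : ℂ)‖ₑ ^ 2
        = ENNReal.ofReal (qf S x) := by
      rw [← h.tsum_eq, ENNReal.ofReal_tsum_of_nonneg (fun i => by positivity) h.summable]
      refine tsum_congr fun i => ?_
      rw [enorm_sq_eq_ofReal, ENNReal.ofReal_mul (by positivity)]
    rw [h1, enorm_sq_eq_ofReal, enorm_sq_eq_ofReal, ← ENNReal.ofReal_add (by positivity) h0, hqS]
    congr 1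
    ring
  refine ⟨I, fun i => ν i ^ 2, fun i => e i, l, hl, he, hpos, fun i => ?_, ?_, hid⟩
  · have h1 := (ENNReal.le_tsum (f := fun j : I =>
      ENNReal.ofReal (ν j ^ 2) * ‖(inner ℂ (e j) (e i) : ℂ)‖ₑ ^ 2) i).trans
      (le_add_self.trans (hid (e i)).le)
    have h2 : ‖e i‖ = 1 := he.1 i
    rw [inner_self_eq_norm_sq_to_K, enorm_sq_eq_ofReal, enorm_sq_eq_ofReal, h2] at h1
    simpa using h1
  · refine ne_top_of_le_ne_top hZ ?_
    have h1 : ∀ i : I, ENNReal.ofReal (Real.exp (-(l / ν i ^ 2)))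
        = (fun j => if ν j = 0 then 0 else ENNReal.ofReal (Real.exp (-(l / ν j ^ 2)))) i :=
      fun i => (if_neg i.2).symm
    rw [tsum_congr h1]
    exact ENNReal.tsum_comp_le_tsum_of_injective Subtype.val_injective _

end Defect

section TraceNormFilter

variable {E F : Type*}
variable [NormedAddCommGroup E] [InnerProductSpace ℂ E] [CompleteSpace E]
variable [NormedAddCommGroup F] [InnerProductSpace ℂ F] [CompleteSpace F]
variable {ι : Type*} [Fintype ι]

/-- The trace-norm neighbourhoods of `A` within `𝒜`. -/
def tnNhds (A : E →L[ℂ] E) (𝒜 : Set (E →L[ℂ] E)) : Filter (E →L[ℂ] E) :=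
  comap (fun B => traceNorm (B - A)) (𝓝 0) ⊓ 𝓟 𝒜

theorem eventually_mem (A : E →L[ℂ] E) (𝒜 : Set (E →L[ℂ] E)) : ∀ᶠ B in tnNhds A 𝒜, B ∈ 𝒜 :=
  mem_inf_of_right (mem_principal_self 𝒜)

theorem eventually_traceNorm_lt (A : E →L[ℂ] E) (𝒜 : Set (E →L[ℂ] E)) {δ : ℝ} (hδ : 0 < δ) :
    ∀ᶠ B in tnNhds A 𝒜, traceNorm (B - A) < ENNReal.ofReal δ :=
  mem_inf_of_left (preimage_mem_comap (Iio_mem_nhds (by simpa using hδ)))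

theorem exists_of_eventually {A : E →L[ℂ] E} {𝒜 : Set (E →L[ℂ] E)} {P : (E →L[ℂ] E) → Prop}
    (h : ∀ᶠ B in tnNhds A 𝒜, P B) :
    ∃ δ : ℝ, 0 < δ ∧ ∀ B ∈ 𝒜, traceNorm (B - A) < ENNReal.ofReal δ → P B := by
  rw [tnNhds, eventually_inf_principal,
    (ENNReal.nhds_zero_basis.comap _).eventually_iff] at h
  obtain ⟨c, hc, h⟩ := h
  have hmin : min c 1 ≠ ∞ := ne_top_of_le_ne_top ENNReal.one_ne_top (min_le_right _ _)
  refine ⟨(min c 1).toReal, ENNReal.toReal_pos (lt_min hc one_pos).ne' hmin, fun B hB hBA => ?_⟩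
  rw [ENNReal.ofReal_toReal hmin] at hBA
  exact h (hBA.trans_le (min_le_left _ _)) hB

theorem tnNhds_le (A : E →L[ℂ] E) (𝒜 : Set (E →L[ℂ] E)) : tnNhds A 𝒜 ≤ 𝓝 A := by
  rw [Metric.nhds_basis_closedBall.ge_iff]
  intro δ hδ
  filter_upwards [eventually_traceNorm_lt A 𝒜 hδ] with B hB
  rw [mem_closedBall_iff_norm]
  exact norm_le_of_traceNorm_le hδ.le hB.le

theorem continuous_qf (x : E) : Continuous fun B : E →L[ℂ] E => qf B x := by
  unfold qf
  fun_prop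

theorem continuous_conj (T : E →L[ℂ] F) : Continuous fun B : E →L[ℂ] E => conj T B := by
  unfold conj
  fun_prop

/-- The component of a vector orthogonal to a finite orthonormal family. -/
def res (f : ι → E) : E →L[ℂ] E := 1 - ContinuousLinearMap.adjoint (anal f) ∘L anal f

theorem norm_anal_sq_add {f : ι → E} (hf : Orthonormal ℂ f) (x : E) :
    ‖anal f x‖ ^ 2 + ‖res f x‖ ^ 2 = ‖x‖ ^ 2 := by
  have h1 : ‖ContinuousLinearMap.adjoint (anal f) (anal f x)‖ ^ 2 = ‖anal f x‖ ^ 2 := by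
    rw [norm_adjoint_anal_sq hf, EuclideanSpace.norm_sq_eq]
  have h2 : RCLike.re (inner ℂ x (ContinuousLinearMap.adjoint (anal f) (anal f x)) : ℂ)
      = ‖anal f x‖ ^ 2 := by
    rw [ContinuousLinearMap.adjoint_inner_right, inner_self_eq_norm_sq]
  have h3 : res f x = x - ContinuousLinearMap.adjoint (anal f) (anal f x) := rfl
  rw [h3, @norm_sub_sq ℂ, h1, h2]
  ring

theorem isFrame_single :
    IsFrame (fun i : ι => (EuclideanSpace.single i (1 : ℂ) : EuclideanSpace ℂ ι)) := by
  intro x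
  rw [tsum_fintype]
  simp only [EuclideanSpace.inner_single_left, map_one, one_mul, enorm_sq_eq_ofReal]
  rw [← ENNReal.ofReal_sum_of_nonneg (fun _ _ => by positivity), EuclideanSpace.norm_sq_eq]

theorem ptr_conj_anal {A : E →L[ℂ] E} (hA : A.IsPositive) (f : ι → E) :
    ptr (conj (anal f) A) = ∑ i, ENNReal.ofReal (qf A (f i)) := by
  rw [← isFrame_single.tsum_qf (isPositive_conj hA _), tsum_fintype]
  refine Finset.sum_congr rfl fun i _ => ?_
  rw [qf_conj, adjoint_anal]
  simp

theorem conj_comp (S : F →L[ℂ] F) (V : E →L[ℂ] F) (A : E →L[ℂ] E) :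
    conj (S ∘L V) A = conj S (conj V A) := by
  simp only [conj, ContinuousLinearMap.adjoint_comp, ContinuousLinearMap.comp_assoc]

end TraceNormFilter

section Continuity

variable {E F : Type*}
variable [NormedAddCommGroup E] [InnerProductSpace ℂ E] [CompleteSpace E]
variable [NormedAddCommGroup F] [InnerProductSpace ℂ F] [CompleteSpace F]
variable {𝒜 : Set (E →L[ℂ] E)} {A : E →L[ℂ] E}

theorem eventually_Hc_lt {G : Type*} [NormedAddCommGroup G] [InnerProductSpace ℂ G]
    [CompleteSpace G] [FiniteDimensional ℂ G] (h𝒜 : 𝒜 ⊆ posTC E) (hA : A ∈ 𝒜) (T : E →L[ℂ] G)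
    {g : Set G} (hg : IsONB g) {c : ℝ≥0∞}
    (hc : Hc (fun i : g => ENNReal.ofReal (qf (conj T A) i)) < c) :
    ∀ᶠ B in tnNhds A 𝒜, Hc (fun i : g => ENNReal.ofReal (qf (conj T B) i)) < c := by
  have : Fintype g := (hg.1.linearIndependent.setFinite).fintype
  have heq : ∀ B ∈ 𝒜, Hc (fun i : g => ENNReal.ofReal (qf (conj T B) i))
      = ENNReal.ofReal (∑ i : g, Real.negMulLog (qf (conj T B) i)
        - Real.negMulLog (∑ i : g, qf (conj T B) i)) := fun B hB =>
    Hc_eq_of_fintype fun i => qf_nonneg (isPositive_conj (h𝒜 hB).1 T) _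
  have hq : ∀ x : G, Continuous fun B : E →L[ℂ] E => qf (conj T B) x := fun x =>
    (continuous_qf x).comp (continuous_conj T)
  have hcont : Continuous fun B : E →L[ℂ] E =>
      ENNReal.ofReal (∑ i : g, Real.negMulLog (qf (conj T B) i)
        - Real.negMulLog (∑ i : g, qf (conj T B) i)) := by
    refine ENNReal.continuous_ofReal.comp (Continuous.sub ?_ ?_)
    · exact continuous_finsetSum _ fun i _ => Real.continuous_negMulLog.comp (hq _)
    · exact Real.continuous_negMulLog.comp (continuous_finsetSum _ fun i _ => hq _)
  rw [heq A hA] at hc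
  filter_upwards [tnNhds_le A 𝒜 (hcont.continuousAt.eventually_lt_const hc), eventually_mem A 𝒜]
    with B hB hBmem
  rwa [heq B hBmem]

theorem ContOn.eventually_le {f : (E →L[ℂ] E) → ℝ≥0∞} (hf : ContOn f 𝒜) (hA : A ∈ 𝒜) {ε : ℝ}
    (hε : 0 < ε) : ∀ᶠ B in tnNhds A 𝒜, f B ≤ f A + ENNReal.ofReal ε := by
  obtain ⟨δ, hδ, h⟩ := hf.2 A hA ε hε
  filter_upwards [eventually_traceNorm_lt A 𝒜 hδ, eventually_mem A 𝒜] with B hB hBmem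
  have h1 := (abs_lt.1 (h B hBmem hB)).2
  rw [← ENNReal.ofReal_toReal (hf.1 A hA), ← ENNReal.ofReal_toReal (hf.1 B hBmem),
    ← ENNReal.ofReal_add ENNReal.toReal_nonneg hε.le]
  exact ENNReal.ofReal_le_ofReal (by linarith)

theorem contOn_of_eventually {f : (E →L[ℂ] E) → ℝ≥0∞} (hfin : ∀ A ∈ 𝒜, f A ≠ ∞)
    (hle : ∀ A ∈ 𝒜, ∀ ε : ℝ, 0 < ε → ∀ᶠ B in tnNhds A 𝒜, f B ≤ f A + ENNReal.ofReal ε)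
    (hge : ∀ A ∈ 𝒜, ∀ ε : ℝ, 0 < ε → ∀ᶠ B in tnNhds A 𝒜, f A ≤ f B + ENNReal.ofReal ε) :
    ContOn f 𝒜 := by
  refine ⟨hfin, fun A hA ε hε => exists_of_eventually ?_⟩
  have key : ∀ a b : ℝ≥0∞, b ≠ ∞ → a ≤ b + ENNReal.ofReal (ε / 2) →
      a.toReal ≤ b.toReal + ε / 2 := by
    intro a b hb hab
    have h := ENNReal.toReal_mono (ENNReal.add_ne_top.2 ⟨hb, ENNReal.ofReal_ne_top⟩) hab
    rwa [ENNReal.toReal_add hb ENNReal.ofReal_ne_top, ENNReal.toReal_ofReal (by positivity)] at h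
  filter_upwards [hle A hA (ε / 2) (by positivity), hge A hA (ε / 2) (by positivity),
    eventually_mem A 𝒜] with B h1 h2 hB
  have h3 := key _ _ (hfin A hA) h1
  have h4 := key _ _ (hfin B hB) h2
  rw [abs_lt]
  constructor <;> linarith

/-- Lower semicontinuity of the quantum entropy. -/
theorem eventually_qEntropy_le_add (h𝒜 : 𝒜 ⊆ posTC E) (hA : A ∈ 𝒜) (hfin : qEntropy A ≠ ∞)
    {ε : ℝ} (hε : 0 < ε) : ∀ᶠ B in tnNhds A 𝒜, qEntropy A ≤ qEntropy B + ENNReal.ofReal ε := by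
  have hpos := (h𝒜 hA).1
  have htr := ptr_ne_top (h𝒜 hA)
  obtain ⟨s, hs, hse⟩ := exists_eigenbasis hpos htr
  obtain ⟨Φ, -, δ, hδ, h⟩ := exists_compression hpos htr hfin hs hse hε
  filter_upwards [tnNhds_le A 𝒜 (Metric.closedBall_mem_nhds A hδ), eventually_mem A 𝒜]
    with B hB hBmem
  refine (h B (h𝒜 hBmem).1 (ptr_ne_top (h𝒜 hBmem)) (mem_closedBall_iff_norm.1 hB)).trans ?_
  gcongr
  exact qEntropy_conj_le (h𝒜 hBmem).1 (ptr_ne_top (h𝒜 hBmem))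
    (norm_anal_sq_le (hs.1.comp _ Subtype.val_injective))

/-- Continuity of the output entropy makes the entropy of a tail compression uniformly small. -/
theorem exists_residual {V : E →L[ℂ] F} (hV : ∀ x, ‖V x‖ ^ 2 ≤ ‖x‖ ^ 2) (h𝒜 : 𝒜 ⊆ posTC E)
    (hcont : ContOn (fun A => qEntropy (conj V A)) 𝒜) (hA : A ∈ 𝒜) {η : ℝ} (hη : 0 < η) :
    ∃ (s : Set F) (Φ : Finset s), Orthonormal ℂ (fun v : Φ => ((v : s) : F)) ∧
      ptr (conj (res (fun v : Φ => ((v : s) : F)) ∘L V) A) ≤ ENNReal.ofReal η ∧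
      ∀ᶠ B in tnNhds A 𝒜, qEntropy (conj (res (fun v : Φ => ((v : s) : F)) ∘L V) B)
        ≤ ENNReal.ofReal (2 * η) := by
  have htop : ∀ B ∈ 𝒜, ptr (conj V B) ≠ ∞ := fun B hB =>
    ne_top_of_le_ne_top (ptr_ne_top (h𝒜 hB)) (ptr_conj_le (h𝒜 hB).1 hV)
  have hpos : ∀ B ∈ 𝒜, (conj V B).IsPositive := fun B hB => isPositive_conj (h𝒜 hB).1 V
  obtain ⟨s, hs, hse⟩ := exists_eigenbasis (hpos A hA) (htop A hA)
  obtain ⟨Φ, hΦ, δ, hδ, h⟩ :=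
    exists_compression (hpos A hA) (htop A hA) (hcont.1 A hA) hs hse hη
  have horth : Orthonormal ℂ (fun v : Φ => ((v : s) : F)) := hs.1.comp _ Subtype.val_injective
  have hres := fun x => (norm_anal_sq_add horth x).le
  refine ⟨s, Φ, horth, ?_, ?_⟩
  · have h1 := (ptr_conj_add_le (hpos A hA) hres).trans hΦ
    rw [conj_comp]
    rw [ptr_conj_anal (hpos A hA), Finset.sum_coe_sort Φ (fun v => ENNReal.ofReal (qf (conj V A) v))]
      at h1
    exact (ENNReal.add_le_add_iff_left
      (ENNReal.sum_lt_top.2 fun v _ => ENNReal.ofReal_lt_top).ne).1 h1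
  · have hnear := tnNhds_le A 𝒜
      ((continuous_conj V).continuousAt.preimage_mem_nhds (Metric.closedBall_mem_nhds _ hδ))
    filter_upwards [hnear, hcont.eventually_le hA hη, eventually_mem A 𝒜] with B hB hBle hBmem
    have h1 := h _ (hpos B hBmem) (htop B hBmem) (mem_closedBall_iff_norm.1 hB)
    have h2 := qEntropy_conj_add_le (hpos B hBmem) (htop B hBmem) hres
    have h3 : qEntropy (conj (anal fun v : Φ => ((v : s) : F)) (conj V B)) ≠ ∞ :=
      ne_top_of_le_ne_top (hcont.1 B hBmem) (le_self_add.trans h2)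
    rw [conj_comp, two_mul, ENNReal.ofReal_add hη.le hη.le]
    refine (ENNReal.add_le_add_iff_left h3).1 (h2.trans (hBle.trans ?_))
    rw [← add_assoc]
    gcongr

end Continuity

section Main

variable {E F : Type*}
variable [NormedAddCommGroup E] [InnerProductSpace ℂ E] [CompleteSpace E]
variable [NormedAddCommGroup F] [InnerProductSpace ℂ F] [CompleteSpace F]
variable {I : Type*} {V : E →L[ℂ] F} {q : I → ℝ} {e : I → E} {l : ℝ}

theorem tsum_qf_ne_top {A : E →L[ℂ] E} (hA : A ∈ posTC E) (he : Orthonormal ℂ e) :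
    ∑' i, ENNReal.ofReal (qf A (e i)) ≠ ∞ := by
  have h := tsum_qf_le_add 0 A he
  have h0 : ∀ x : E, qf (0 : E →L[ℂ] E) x = 0 := by simp [qf]
  simp only [h0, ENNReal.ofReal_zero, tsum_zero, zero_add, sub_zero] at h
  exact ne_top_of_le_ne_top hA.2 h

theorem qEntropy_ne_top (hl : 0 ≤ l) (he : Orthonormal ℂ e) (hq0 : ∀ i, 0 < q i)
    (hq1 : ∀ i, q i ≤ 1) (hZ : ∑' i, ENNReal.ofReal (Real.exp (-(l / q i))) ≠ ∞)
    (hid : ∀ x, ‖V x‖ₑ ^ 2 + ∑' i, ENNReal.ofReal (q i) * ‖(inner ℂ (e i) x : ℂ)‖ₑ ^ 2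
      = ‖x‖ₑ ^ 2)
    {A : E →L[ℂ] E} (hA : A ∈ posTC E) (hVA : qEntropy (conj V A) ≠ ∞) : qEntropy A ≠ ∞ := by
  have hres : IsResolution (0 : E →L[ℂ] E) V q e := fun x => by simpa using hid x
  have htr := ptr_ne_top hA
  have hτ := tsum_qf_ne_top hA he
  have hσ := hres.ptr_eq (fun i => (hq0 i).le) hA.1
  have hσt := ne_top_of_le_ne_top htr (hσ ▸ le_add_self)
  refine ne_top_of_le_ne_top ?_
    (hres.qEntropy_le hq0 hq1 hl hA.1 htr isONB_stdONB le_rfl rfl)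
  have hH : Hc (fun i : stdONB E => ENNReal.ofReal (qf (conj (0 : E →L[ℂ] E) A) i)) = 0 := by
    simp [Hc, qf]
  rw [hH]
  finiteness

/-- Splitting off finitely many vectors from the resolution of identity. -/
theorem isResolution_anal (hq0 : ∀ i, 0 < q i)
    (hid : ∀ x, ‖V x‖ₑ ^ 2 + ∑' i, ENNReal.ofReal (q i) * ‖(inner ℂ (e i) x : ℂ)‖ₑ ^ 2
      = ‖x‖ₑ ^ 2)
    {ι : Type*} [Fintype ι] {f : ι → F} (hf : Orthonormal ℂ f) (J : Finset I) :
    IsResolution (anal (Sum.elim (fun k => ContinuousLinearMap.adjoint V (f k))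
      (fun j : J => (√(q j) : ℂ) • e j))) (res f ∘L V)
      (fun k : {i // i ∉ J} => q k) (fun k : {i // i ∉ J} => e k) := by
  intro x
  have h1 : ∀ (κ : Type _) [Fintype κ] (h : κ → E) (x : E),
      ‖anal h x‖ₑ ^ 2 = ∑ k, ‖(inner ℂ (h k) x : ℂ)‖ₑ ^ 2 := by
    intro κ _ h x
    simp only [enorm_sq_eq_ofReal, norm_anal_sq]
    exact ENNReal.ofReal_sum_of_nonneg fun _ _ => by positivity
  have h2 : ∑ k, ‖(inner ℂ (f k) (V x) : ℂ)‖ₑ ^ 2 + ‖res f (V x)‖ₑ ^ 2 = ‖V x‖ₑ ^ 2 := by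
    simp only [enorm_sq_eq_ofReal]
    rw [← norm_anal_sq_add hf (V x), norm_anal_sq,
      ENNReal.ofReal_add (by positivity) (by positivity),
      ENNReal.ofReal_sum_of_nonneg fun _ _ => by positivity]
  have h3 : ∑ j : J, ENNReal.ofReal (q j) * ‖(inner ℂ (e j) x : ℂ)‖ₑ ^ 2
      + ∑' k : {i // i ∉ J}, ENNReal.ofReal (q k) * ‖(inner ℂ (e k) x : ℂ)‖ₑ ^ 2
      = ∑' i, ENNReal.ofReal (q i) * ‖(inner ℂ (e i) x : ℂ)‖ₑ ^ 2 := by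
    have := Summable.tsum_add_tsum_compl (s := (J : Set I))
      (f := fun i => ENNReal.ofReal (q i) * ‖(inner ℂ (e i) x : ℂ)‖ₑ ^ 2)
      ENNReal.summable ENNReal.summable
    have hJ : ∑' j : J, ENNReal.ofReal (q j) * ‖(inner ℂ (e j) x : ℂ)‖ₑ ^ 2
        = ∑ j : J, ENNReal.ofReal (q j) * ‖(inner ℂ (e j) x : ℂ)‖ₑ ^ 2 := tsum_fintype _
    rw [← this, ← hJ]
    rfl
  rw [h1, Fintype.sum_sum_type]
  simp only [Sum.elim_inl, Sum.elim_inr, ContinuousLinearMap.adjoint_inner_left,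
    enorm_inner_sqrt_smul_sq (hq0 _).le, ContinuousLinearMap.comp_apply]
  rw [← hid x, ← h2, ← h3]
  ring

/-- Upper semicontinuity of the quantum entropy, inherited from the output entropy. -/
theorem eventually_qEntropy_le (hl : 0 < l) (he : Orthonormal ℂ e) (hq0 : ∀ i, 0 < q i)
    (hq1 : ∀ i, q i ≤ 1) (hZ : ∑' i, ENNReal.ofReal (Real.exp (-(l / q i))) ≠ ∞)
    (hid : ∀ x, ‖V x‖ₑ ^ 2 + ∑' i, ENNReal.ofReal (q i) * ‖(inner ℂ (e i) x : ℂ)‖ₑ ^ 2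
      = ‖x‖ₑ ^ 2)
    (hV : ∀ x, ‖V x‖ ^ 2 ≤ ‖x‖ ^ 2) {𝒜 : Set (E →L[ℂ] E)} (h𝒜 : 𝒜 ⊆ posTC E)
    (hcont : ContOn (fun A => qEntropy (conj V A)) 𝒜) {A : E →L[ℂ] E} (hA : A ∈ 𝒜)
    (hfin : qEntropy A ≠ ∞) {ε : ℝ} (hε : 0 < ε) :
    ∀ᶠ B in tnNhds A 𝒜, qEntropy B ≤ qEntropy A + ENNReal.ofReal ε := by
  have htr := ptr_ne_top (h𝒜 hA)
  obtain ⟨K, hKε, hK⟩ : ∃ K : ℝ, ((ptr A).toReal + 1) * Real.exp (-K) < ε / 3 ∧ 0 ≤ K := by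
    have h : Tendsto (fun K : ℝ => ((ptr A).toReal + 1) * Real.exp (-K)) atTop (𝓝 0) := by
      simpa using Real.tendsto_exp_neg_atTop_nhds_zero.const_mul ((ptr A).toReal + 1)
    exact ((h.eventually_lt_const (by positivity)).and (eventually_ge_atTop 0)).exists
  set Z := ∑' i, ENNReal.ofReal (Real.exp (-(l / q i))) with hZdef
  have hZ0 : 0 ≤ Z.toReal := ENNReal.toReal_nonneg
  let η : ℝ := ε / 3 / (2 + (l + Z.toReal) * 2 + (3 + K) * 4)
  have hη : 0 < η := by positivity
  have hηsum : 2 * η + (l + Z.toReal) * (2 * η) + (3 + K) * (4 * η) = ε / 3 := by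
    have : η * (2 + (l + Z.toReal) * 2 + (3 + K) * 4) = ε / 3 :=
      div_mul_cancel₀ _ (by positivity)
    linarith
  obtain ⟨J, hJ⟩ : ∃ J : Finset I,
      ∑' k : {i // i ∉ J}, ENNReal.ofReal (qf A (e k)) < ENNReal.ofReal η :=
    ((ENNReal.tendsto_tsum_compl_atTop_zero (tsum_qf_ne_top (h𝒜 hA) he)).eventually_lt_const
      (by simpa using hη)).exists
  obtain ⟨s, Φ, horth, hptr, hent⟩ := exists_residual hV h𝒜 hcont hA hη
  set f : Φ → F := fun v => ((v : s) : F)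
  set h : Φ ⊕ J → E := Sum.elim (fun k => ContinuousLinearMap.adjoint V (f k))
    (fun j : J => (√(q j) : ℂ) • e j)
  have hres : IsResolution (anal h) (res f ∘L V) (fun k : {i // i ∉ J} => q k)
      (fun k : {i // i ∉ J} => e k) := isResolution_anal hq0 hid horth J
  have hT : ∀ x, ‖anal h x‖ ^ 2 ≤ ‖x‖ ^ 2 := by
    intro x
    have h1 : ‖anal h x‖ₑ ^ 2 ≤ ‖x‖ₑ ^ 2 := le_self_add.trans (hres x).le
    rwa [enorm_sq_eq_ofReal, enorm_sq_eq_ofReal, ENNReal.ofReal_le_ofReal_iff (by positivity)] at h1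
  let τ : (E →L[ℂ] E) → ℝ≥0∞ := fun B => ∑' k : {i // i ∉ J}, ENNReal.ofReal (qf B (e k))
  let σ : (E →L[ℂ] E) → ℝ≥0∞ := fun B => ptr (conj (res f ∘L V) B)
    + ∑' k : {i // i ∉ J}, ENNReal.ofReal (q k) * ENNReal.ofReal (qf B (e k))
  have hq0' : ∀ k : {i // i ∉ J}, 0 ≤ q k := fun k => (hq0 k).le
  have hσ : ∀ B ∈ 𝒜, ptr (conj (anal h) B) + σ B = ptr B := fun B hB =>
    hres.ptr_eq hq0' (h𝒜 hB).1
  have hσA : σ A ≤ ENNReal.ofReal η + ENNReal.ofReal η := by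
    refine add_le_add hptr (le_trans (ENNReal.tsum_le_tsum fun k => ?_) hJ.le)
    calc _ ≤ 1 * ENNReal.ofReal (qf A (e k)) := by
          refine mul_le_mul_left ?_ _
          rw [← ENNReal.ofReal_one]
          exact ENNReal.ofReal_le_ofReal (hq1 k)
      _ = _ := one_mul _
  have htT : ptr (conj (anal h) A) ≠ ∞ := ne_top_of_le_ne_top htr (ptr_conj_le (h𝒜 hA).1 hT)
  obtain ⟨g, hg, hgA⟩ := exists_isONB_Hc_le (isPositive_conj (h𝒜 hA).1 (anal h)) htT
    (c := qEntropy A + ENNReal.ofReal (ε / 3))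
    ((qEntropy_conj_le (h𝒜 hA).1 htr hT).trans_lt
      (ENNReal.lt_add_right hfin (by simpa using by positivity)))
  have hTB : ∀ᶠ B in tnNhds A 𝒜,
      ptr (conj (anal h) A) < ptr (conj (anal h) B) + ENNReal.ofReal η := by
    have hc : Continuous fun B : E →L[ℂ] E =>
        ∑ k, ENNReal.ofReal (qf B (h k)) + ENNReal.ofReal η :=
      (continuous_finsetSum _ fun k _ => ENNReal.continuous_ofReal.comp (continuous_qf _)).add
        continuous_const
    have hlt : ptr (conj (anal h) A) < ∑ k, ENNReal.ofReal (qf A (h k)) + ENNReal.ofReal η := by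
      rw [← ptr_conj_anal (h𝒜 hA).1]
      exact ENNReal.lt_add_right htT (by simpa using hη)
    filter_upwards [tnNhds_le A 𝒜 (hc.continuousAt.eventually_const_lt hlt), eventually_mem A 𝒜]
      with B hB hBmem
    rwa [ptr_conj_anal (h𝒜 hBmem).1]
  filter_upwards [hent, hTB, eventually_Hc_lt h𝒜 hA (anal h) hg hgA,
    eventually_traceNorm_lt A 𝒜 hη, eventually_traceNorm_lt A 𝒜 one_pos, eventually_mem A 𝒜]
    with B hBent hBT hBH hBη hB1 hBmem
  have hBpos := (h𝒜 hBmem).1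
  have hBtr := ptr_ne_top (h𝒜 hBmem)
  have hτB : τ B ≤ ENNReal.ofReal (2 * η) := by
    rw [two_mul, ENNReal.ofReal_add hη.le hη.le]
    exact (tsum_qf_le_add A B (he.comp _ Subtype.val_injective)).trans (add_le_add hJ.le hBη.le)
  have hσB : σ B ≤ ENNReal.ofReal (4 * η) := by
    have hBTt : ptr (conj (anal h) B) ≠ ∞ :=
      ne_top_of_le_ne_top hBtr (ptr_conj_le hBpos hT)
    refine (ENNReal.add_le_add_iff_left hBTt).1 ?_
    rw [hσ B hBmem]
    calc ptr B ≤ ptr A + traceNorm (B - A) := ptr_le_add A B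
      _ ≤ ptr (conj (anal h) A) + σ A + ENNReal.ofReal η := by
        rw [hσ A hA]
        gcongr
      _ ≤ (ptr (conj (anal h) B) + ENNReal.ofReal η) + (ENNReal.ofReal η + ENNReal.ofReal η)
          + ENNReal.ofReal η := by gcongr
      _ = _ := by
        rw [show 4 * η = η + η + η + η by ring, ENNReal.ofReal_add (by positivity) hη.le,
          ENNReal.ofReal_add (by positivity) hη.le, ENNReal.ofReal_add hη.le hη.le]
        ring
  have hptrB : ptr B ≤ ENNReal.ofReal ((ptr A).toReal + 1) := by
    rw [ENNReal.ofReal_add ENNReal.toReal_nonneg zero_le_one, ENNReal.ofReal_toReal htr]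
    exact (ptr_le_add A B).trans (by gcongr)
  have hZJ : ∑' k : {i // i ∉ J}, ENNReal.ofReal (Real.exp (-(l / q k)))
      ≤ ENNReal.ofReal Z.toReal := by
    rw [ENNReal.ofReal_toReal hZ]
    exact ENNReal.tsum_comp_le_tsum_of_injective Subtype.val_injective
      (fun i => ENNReal.ofReal (Real.exp (-(l / q i))))
  calc qEntropy B ≤ _ := hres.qEntropy_le (fun k => hq0 k) (fun k => hq1 k) hl.le hBpos hBtr hg hK
        rfl
    _ ≤ ENNReal.ofReal (2 * η) + (qEntropy A + ENNReal.ofReal (ε / 3)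
        + (ENNReal.ofReal l + ENNReal.ofReal Z.toReal) * ENNReal.ofReal (2 * η)
        + (ENNReal.ofReal 3 + ENNReal.ofReal K) * ENNReal.ofReal (4 * η)
        + ENNReal.ofReal ((ptr A).toReal + 1) * ENNReal.ofReal (Real.exp (-K))) := by
      rw [show ENNReal.ofReal 3 = 3 by simp]
      gcongr
    _ = qEntropy A + ENNReal.ofReal (2 * η + (ε / 3 + (l + Z.toReal) * (2 * η)
        + (3 + K) * (4 * η) + ((ptr A).toReal + 1) * Real.exp (-K))) := by
      have h0 : 0 ≤ (ptr A).toReal := ENNReal.toReal_nonneg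
      rw [← ENNReal.ofReal_add hl.le hZ0, ← ENNReal.ofReal_add (by norm_num) hK,
        ← ENNReal.ofReal_mul (by positivity), ← ENNReal.ofReal_mul (by positivity),
        ← ENNReal.ofReal_mul (by positivity), ENNReal.ofReal_add (by positivity) (by positivity),
        ENNReal.ofReal_add (by positivity) (by positivity),
        ENNReal.ofReal_add (by positivity) (by positivity),
        ENNReal.ofReal_add (by positivity) (by positivity)]
      ring
    _ ≤ _ := by
      gcongr
      linarith

end Main

/-- Lemma 3 of the paper. Let `V : ℋ → ℋ'` be a linear contraction
with `λ*(√(I − V*V)) < ∞`.  Then continuity of `A ↦ H(VAV*)` on a subset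
`𝒜 ⊆ 𝔗₊(ℋ)` implies continuity of the quantum entropy on `𝒜`. -/
theorem statement16
    {E F : Type*}
    [NormedAddCommGroup E] [InnerProductSpace ℂ E] [CompleteSpace E]
    [TopologicalSpace.SeparableSpace E]
    [NormedAddCommGroup F] [InnerProductSpace ℂ F] [CompleteSpace F]
    [TopologicalSpace.SeparableSpace F]
    (V : E →L[ℂ] F) (hcontr : ‖V‖ ≤ 1)
    (hlam : LamStarSqrtFin ((1 : E →L[ℂ] E) - ContinuousLinearMap.adjoint V ∘L V))
    (𝒜 : Set (E →L[ℂ] E)) (h𝒜 : 𝒜 ⊆ posTC E)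
    (hcont : ContOn (fun A => qEntropy (V ∘L A ∘L ContinuousLinearMap.adjoint V)) 𝒜) :
    ContOn qEntropy 𝒜 := by
  obtain ⟨I, q, e, l, hl, he, hq0, hq1, hZ, hid⟩ := exists_defect hlam
  have hV : ∀ x, ‖V x‖ ^ 2 ≤ ‖x‖ ^ 2 := fun x => by
    gcongr
    exact (V.le_of_opNorm_le hcontr x).trans_eq (one_mul _)
  have hfin : ∀ A ∈ 𝒜, qEntropy A ≠ ∞ := fun A hA =>
    qEntropy_ne_top hl.le he hq0 hq1 hZ hid (h𝒜 hA) (hcont.1 A hA)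
  exact contOn_of_eventually hfin
    (fun A hA ε hε =>
      eventually_qEntropy_le hl he hq0 hq1 hZ hid hV h𝒜 hcont hA (hfin A hA) hε)
    (fun A hA ε hε => eventually_qEntropy_le_add h𝒜 hA (hfin A hA) hε)

end QIT
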